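/- arXiv:1212.4056 — 4 statements merged into one kernel-verified Lean document; each statement's English description precedes it below -/
import Mathlib

section
/- Let F and F' be finite fields of the same characteristic, both of cardinality at least 4, and let H be a subgroup of SL(2, F) × SL(2, F') whose projections to both factors are surjective. Then either H = SL(2, F) × SL(2, F'), or there exist a ring isomorphism e : F ≅ F' and an element (g₁, g₂) ∈ GL(2, F) × GL(2, F') such that the conjugate subgroup (g₁, g₂)·H·(g₁, g₂)⁻¹ is equal either to the graph {(x, e(x)) : x ∈ SL(2, F)} or to the subgroup {(x, y) ∈ SL(2, F) × SL(2, F') : y = e(x) or y = −e(x)}, where e(x) denotes the matrix obtained by applying e to each entry of x. -/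
open Matrix

namespace SL2Goursat

open scoped MatrixGroups

open Matrix.SpecialLinearGroup

/-- The upper unitriangular matrix `[[1, t], [0, 1]]` in `SL(2, R)`. -/
def upper {R : Type*} [CommRing R] (t : R) : SL(2, R) := ⟨!![1, t; 0, 1], by simp⟩

/-- The Weyl element `[[0, 1], [-1, 0]]` in `SL(2, R)`. -/
def weyl (R : Type*) [CommRing R] : SL(2, R) := ⟨!![0, 1; -1, 0], by simp⟩

section CommRing

variable {R : Type*} [CommRing R]

@[simp] lemma coe_upper (t : R) : (upper t : Matrix (Fin 2) (Fin 2) R) = !![1, t; 0, 1] := rfl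

@[simp] lemma coe_weyl : (weyl R : Matrix (Fin 2) (Fin 2) R) = !![0, 1; -1, 0] := rfl

lemma ext_entries {x y : SL(2, R)} (h₀₀ : x 0 0 = y 0 0) (h₀₁ : x 0 1 = y 0 1)
    (h₁₀ : x 1 0 = y 1 0) (h₁₁ : x 1 1 = y 1 1) : x = y := by
  ext i j
  fin_cases i <;> fin_cases j <;> assumption

lemma det_entries (x : SL(2, R)) : x 0 0 * x 1 1 - x 0 1 * x 1 0 = 1 := by
  rw [← Matrix.det_fin_two]
  exact x.det_coe

lemma upper_add (s t : R) : upper (s + t) = upper s * upper t := by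
  apply ext_entries <;> simp [Matrix.mul_apply, add_comm]

lemma upper_zero : upper (0 : R) = 1 := by
  apply ext_entries <;> simp

lemma upper_inv (t : R) : (upper t)⁻¹ = upper (-t) := by
  rw [inv_eq_iff_mul_eq_one, ← upper_add, add_neg_cancel, upper_zero]

lemma upper_pow (t : R) (n : ℕ) : upper t ^ n = upper (n * t) := by
  induction n with
  | zero => simp [upper_zero]
  | succ n ih => rw [pow_succ, ih, ← upper_add]; congr 1; push_cast; ring

lemma upper_pow_char (p : ℕ) [CharP R p] (t : R) : upper t ^ p = 1 := by
  simp [upper_pow, upper_zero]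

lemma transvection_zero_one (h : (0 : Fin 2) ≠ 1) (t : R) : transvection h t = upper t := by
  apply ext_entries <;> simp [transvection_coe]

lemma transvection_one_zero (h : (1 : Fin 2) ≠ 0) (t : R) :
    transvection h t = weyl R * upper (-t) * (weyl R)⁻¹ := by
  rw [eq_mul_inv_iff_mul_eq]
  apply ext_entries <;> simp [transvection_coe, Matrix.mul_apply]

/-- Conjugation by an invertible matrix as an automorphism of `SL(2, R)`. -/
def conjGL (g : GL (Fin 2) R) : SL(2, R) →* SL(2, R) where
  toFun x := ⟨g * x * (g⁻¹ : GL (Fin 2) R), by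
    rw [Matrix.det_mul, Matrix.det_mul, mul_right_comm, ← Matrix.det_mul]; simp⟩
  map_one' := Subtype.ext <| by simp
  map_mul' x y := Subtype.ext <| by
    change (g : Matrix (Fin 2) (Fin 2) R) * (x * y : SL(2, R)) * (g⁻¹ : GL (Fin 2) R) =
      g * x * (g⁻¹ : GL (Fin 2) R) * (g * y * (g⁻¹ : GL (Fin 2) R))
    simp only [coe_mul, mul_assoc, Units.inv_mul_cancel_left]

lemma coe_conjGL (g : GL (Fin 2) R) (x : SL(2, R)) :
    (conjGL g x : Matrix (Fin 2) (Fin 2) R) = g * x * (g⁻¹ : GL (Fin 2) R) := rfl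

lemma conjGL_toGL (s x : SL(2, R)) : conjGL (toGL s) x = s * x * s⁻¹ :=
  Subtype.ext <| by simp only [coe_conjGL, ← map_inv, coe_mul, coe_GL_coe_matrix]

lemma conjGL_mul (g h : GL (Fin 2) R) (x : SL(2, R)) :
    conjGL (g * h) x = conjGL g (conjGL h x) :=
  Subtype.ext <| by simp only [coe_conjGL, _root_.mul_inv_rev, Units.val_mul, mul_assoc]

lemma conjGL_one (x : SL(2, R)) : conjGL 1 x = x :=
  Subtype.ext <| by simp [coe_conjGL]

lemma conjGL_inv_conjGL (g : GL (Fin 2) R) (x : SL(2, R)) : conjGL g⁻¹ (conjGL g x) = x := by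
  rw [← conjGL_mul, inv_mul_cancel, conjGL_one]

lemma conjGL_conjGL_inv (g : GL (Fin 2) R) (x : SL(2, R)) : conjGL g (conjGL g⁻¹ x) = x := by
  rw [← conjGL_mul, mul_inv_cancel, conjGL_one]

lemma conjGL_neg_one (g : GL (Fin 2) R) : conjGL g (-1) = -1 :=
  Subtype.ext <| by simp [coe_conjGL]

end CommRing

section Field

variable {F : Type*} [Field F]

lemma upper_generate (P : SL(2, F) → Prop) (hu : ∀ t, P (upper t)) (hw : P (weyl F))
    (hmul : ∀ x y, P x → P y → P (x * y)) (x : SL(2, F)) : P x := by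
  have hw' : P (weyl F)⁻¹ := by
    have : (weyl F)⁻¹ = weyl F * weyl F * weyl F := by
      rw [inv_eq_iff_mul_eq_one]
      apply ext_entries <;> simp [Matrix.mul_apply]
    rw [this]
    exact hmul _ _ (hmul _ _ hw hw) hw
  refine SL2.transvection_induction P (fun i j hij c ↦ ?_) hmul x
  fin_cases i <;> fin_cases j
  · exact absurd rfl hij
  · exact transvection_zero_one hij c ▸ hu c
  · exact transvection_one_zero hij c ▸ hmul _ _ (hmul _ _ hw (hu _)) hw'
  · exact absurd rfl hij

lemma eq_one_or_neg_one_of_mem_center {x : SL(2, F)} (hx : x ∈ Subgroup.center SL(2, F)) :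
    x = 1 ∨ x = -1 := by
  obtain ⟨r, hr, hrx⟩ := mem_center_iff.1 hx
  rw [Fintype.card_fin, sq_eq_one_iff] at hr
  refine hr.imp (fun h ↦ Subtype.ext ?_) (fun h ↦ Subtype.ext ?_)
  · simp [← hrx, h]
  · rw [← hrx, h, map_neg, map_one, coe_neg, coe_one]

lemma exists_ne_zero_sq_ne_one [Fintype F] (hF : 4 ≤ Fintype.card F) :
    ∃ a : F, a ≠ 0 ∧ a ^ 2 ≠ 1 := by
  classical
  by_contra! h
  have hsub : (Finset.univ : Finset F) ⊆ {0, 1, -1} := fun a _ ↦ by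
    by_cases ha : a = 0
    · simp [ha]
    · simpa [ha] using sq_eq_one_iff.1 (h a ha)
  have := (Finset.card_le_card hsub).trans Finset.card_le_three
  rw [Finset.card_univ] at this
  omega

lemma eq_top_of_forall_commutator_mem [Fintype F] (hF : 4 ≤ Fintype.card F)
    {K : Subgroup SL(2, F)} (hK : ∀ x y, x * y * x⁻¹ * y⁻¹ ∈ K) : K = ⊤ := by
  obtain ⟨a, ha, ha'⟩ := exists_ne_zero_sq_ne_one hF
  rw [eq_top_iff, ← SL2.commutator_eq_top ha ha', commutator_def, Subgroup.commutator_le]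
  exact fun x _ y _ ↦ hK x y

lemma normal_eq_top_or_central [Fintype F] (hF : 4 ≤ Fintype.card F) (N : Subgroup SL(2, F))
    [hN : N.Normal] : N = ⊤ ∨ ∀ x ∈ N, x = 1 ∨ x = -1 := by
  let π := QuotientGroup.mk' (Subgroup.center SL(2, F))
  have hπ : Function.Surjective π := QuotientGroup.mk'_surjective _
  have : IsSimpleGroup (SL(2, F) ⧸ Subgroup.center SL(2, F)) :=
    ProjectiveSpecialLinearGroup.rank_two_simple (F := F) (by rwa [Nat.card_eq_fintype_card])
  rcases (hN.map π hπ).eq_bot_or_eq_top with h | h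
  · right
    intro x hx
    apply eq_one_or_neg_one_of_mem_center
    rw [← QuotientGroup.eq_one_iff]
    exact (Subgroup.mem_bot.1 (h ▸ Subgroup.mem_map_of_mem π hx))
  · left
    apply eq_top_of_forall_commutator_mem hF
    have key : ∀ x : SL(2, F), ∃ n ∈ N, ∃ z ∈ Subgroup.center SL(2, F), x = n * z := fun x ↦ by
      obtain ⟨n, hn, hnx⟩ := (h ▸ Subgroup.mem_top (π x) : π x ∈ N.map π)
      exact ⟨n, hn, n⁻¹ * x, QuotientGroup.eq.1 hnx, by group⟩
    intro x y
    obtain ⟨n, hn, z, hz, rfl⟩ := key x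
    obtain ⟨m, hm, w, hw, rfl⟩ := key y
    have hz' := Subgroup.mem_center_iff.1 hz
    have hw' := Subgroup.mem_center_iff.1 hw
    have : n * z * (m * w) * (n * z)⁻¹ * (m * w)⁻¹ = n * m * n⁻¹ * m⁻¹ := by
      calc n * z * (m * w) * (n * z)⁻¹ * (m * w)⁻¹
          = n * (z * (m * w) * z⁻¹) * n⁻¹ * (w⁻¹ * m⁻¹) := by group
        _ = n * m * (w * n⁻¹) * w⁻¹ * m⁻¹ := by rw [← hz' (m * w)]; group
        _ = _ := by rw [← hw' n⁻¹]; group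
    rw [this]
    exact mul_mem (mul_mem (mul_mem hn hm) (inv_mem hn)) (inv_mem hm)

lemma trace_eq_two_of_pow_char (p : ℕ) [Fact p.Prime] [CharP F p] {x : SL(2, F)}
    (hx : x ^ p = 1) : x 0 0 + x 1 1 = 2 := by
  have h : ((x : Matrix (Fin 2) (Fin 2) F) - 1) ^ p = 0 := by
    rw [sub_pow_char_of_commute _ (Commute.one_right _), ← coe_pow, hx]
    simp
  have := (Matrix.isNilpotent_trace_of_isNilpotent ⟨p, h⟩).eq_zero
  simpa [Matrix.trace_fin_two, sub_eq_zero, one_add_one_eq_two] using this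

lemma exists_conjGL_eq_upper_one {x : SL(2, F)} (htr : x 0 0 + x 1 1 = 2) (hx : x ≠ 1) :
    ∃ g : GL (Fin 2) F, conjGL g x = upper 1 := by
  have hdet := det_entries x
  suffices ∃ P : Matrix (Fin 2) (Fin 2) F, P.det ≠ 0 ∧ (x : Matrix (Fin 2) (Fin 2) F) * P =
      P * (upper (1 : F) : SL(2, F)) by
    obtain ⟨P, hP, hxP⟩ := this
    refine ⟨(GeneralLinearGroup.mkOfDetNeZero P hP)⁻¹, Subtype.ext ?_⟩
    rw [coe_conjGL, inv_inv, mul_assoc, Units.inv_mul_eq_iff_eq_mul]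
    exact hxP
  by_cases hc : x 1 0 = 0
  · have ha : x 0 0 = 1 := by
      rw [hc, ← sub_eq_iff_eq_add'.2 htr.symm] at hdet
      have : (x 0 0 - 1) ^ 2 = 0 := by linear_combination -hdet
      exact sub_eq_zero.1 (pow_eq_zero_iff two_ne_zero |>.1 this)
    have hd : x 1 1 = 1 := by linear_combination htr - ha
    have hb : x 0 1 ≠ 0 := fun hb ↦ hx <| ext_entries (by simpa) (by simpa) (by simpa) (by simpa)
    refine ⟨!![x 0 1, 0; 0, 1], by simpa, ?_⟩
    ext i j
    fin_cases i <;> fin_cases j <;> simp [Matrix.mul_apply, ha, hc, hd]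
  · refine ⟨!![x 0 0 - 1, 1; x 1 0, 0], by simpa, ?_⟩
    ext i j
    fin_cases i <;> fin_cases j <;> simp [Matrix.mul_apply] <;> grind

end Field

/-- A subgroup of `SL(2, F) × SL(2, F')` with surjective projections whose intersections with both
factors consist of scalar matrices. -/
structure IsCentralSubdirect {F F' : Type*} [Field F] [Field F']
    (H : Subgroup (SL(2, F) × SL(2, F'))) : Prop where
  fst_surjective : ∀ x, ∃ y, (x, y) ∈ H
  snd_surjective : ∀ y, ∃ x, (x, y) ∈ H
  fst_central : ∀ x, (x, 1) ∈ H → x = 1 ∨ x = -1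
  snd_central : ∀ y, (1, y) ∈ H → y = 1 ∨ y = -1

namespace IsCentralSubdirect

variable {F F' : Type*} [Field F] [Field F'] {H : Subgroup (SL(2, F) × SL(2, F'))}

lemma swap (hH : IsCentralSubdirect H) :
    IsCentralSubdirect (H.comap (MulEquiv.prodComm (M := SL(2, F')) (N := SL(2, F))).toMonoidHom) :=
  ⟨hH.snd_surjective, hH.fst_surjective, hH.snd_central, hH.fst_central⟩

lemma comap_conjGL (hH : IsCentralSubdirect H) (g : GL (Fin 2) F') :
    IsCentralSubdirect (H.comap ((MonoidHom.id _).prodMap (conjGL g))) where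
  fst_surjective x := by
    obtain ⟨y, hy⟩ := hH.fst_surjective x
    exact ⟨conjGL g⁻¹ y, by simpa [conjGL_conjGL_inv] using hy⟩
  snd_surjective y := hH.snd_surjective (conjGL g y)
  fst_central x hx := hH.fst_central x (by simpa using hx)
  snd_central y hy := by
    rw [← conjGL_inv_conjGL g y]
    refine (hH.snd_central (conjGL g y) hy).imp (fun h ↦ ?_) fun h ↦ ?_
    · rw [h, map_one]
    · rw [h, conjGL_neg_one]

lemma snd_eq_or_eq_neg (hH : IsCentralSubdirect H) {x : SL(2, F)} {y y' : SL(2, F')}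
    (h : (x, y) ∈ H) (h' : (x, y') ∈ H) : y = y' ∨ y = -y' := by
  have := H.mul_mem h (H.inv_mem h')
  simp only [Prod.inv_mk, Prod.mk_mul_mk, mul_inv_cancel] at this
  refine (hH.snd_central _ this).imp (fun h ↦ ?_) fun h ↦ ?_
  · exact mul_inv_eq_one.1 h
  · rw [mul_inv_eq_iff_eq_mul.1 h, neg_mul, one_mul]

lemma mul_mem {x x' : SL(2, F)} {y y' : SL(2, F')} (h : (x, y) ∈ H) (h' : (x', y') ∈ H) :
    (x * x', y * y') ∈ H :=
  H.mul_mem h h'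

lemma inv_mem {x : SL(2, F)} {y : SL(2, F')} (h : (x, y) ∈ H) : (x⁻¹, y⁻¹) ∈ H := by
  rw [← Prod.inv_mk]
  exact H.inv_mem h

lemma eq_of_upper_mem (hH : IsCentralSubdirect H) {t t' : F} {s : F'}
    (h : (upper t, upper s) ∈ H) (h' : (upper t', upper s) ∈ H) : t = t' := by
  have := hH.swap.snd_eq_or_eq_neg (x := upper s) (y := upper t) (y' := upper t') h h'
  rcases this with h | h
  · simpa using congr($h 0 1)
  · have h₀ : (1 : F) = -1 := by simpa using congr($h 0 0)
    have h₁ : t = -t' := by simpa using congr($h 0 1)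
    linear_combination h₁ - t' * h₀

lemma mul_upper_eq_or {x : SL(2, F)} {t t' : F} (hH : IsCentralSubdirect H)
    {y : SL(2, F')} {s s' : F'} (hx : x * upper t = upper t' * x) (hxy : (x, y) ∈ H)
    (h : (upper t, upper s) ∈ H) (h' : (upper t', upper s') ∈ H) :
    y * upper s = upper s' * y ∨ y * upper s = -(upper s' * y) :=
  hH.snd_eq_or_eq_neg (hx ▸ mul_mem hxy h) (mul_mem h' hxy)

lemma exists_pow_char_eq_one (hH : IsCentralSubdirect H) (p : ℕ) [Fact p.Prime] [CharP F' p]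
    {x : SL(2, F)} (hx : x ^ p = 1) : ∃ y, (x, y) ∈ H ∧ y ^ p = 1 := by
  obtain ⟨y, hy⟩ := hH.fst_surjective x
  have hyp : (1, y ^ p) ∈ H := by simpa [hx] using H.pow_mem hy p
  rcases hH.snd_central _ hyp with h | h
  · exact ⟨y, hy, h⟩
  rcases (Fact.out : p.Prime).eq_two_or_odd' with rfl | hp
  · refine ⟨y, hy, h.trans (Subtype.ext ?_)⟩
    rw [coe_neg, coe_one]
    exact CharTwo.neg_eq 1
  · refine ⟨y ^ (p + 1), by simpa [pow_succ, hx] using H.pow_mem hy (p + 1), ?_⟩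
    rw [← pow_mul, mul_comm, pow_mul, h, hp.add_one.neg_one_pow]

lemma exists_conj_upper_one (hH : IsCentralSubdirect H) (p : ℕ) [Fact p.Prime] [CharP F p]
    [CharP F' p] : ∃ g : GL (Fin 2) F', (upper 1, conjGL g (upper 1)) ∈ H := by
  obtain ⟨y, hy, hyp⟩ := hH.exists_pow_char_eq_one p (upper_pow_char p (1 : F))
  have hy1 : y ≠ 1 := by
    rintro rfl
    exact one_ne_zero (hH.eq_of_upper_mem (t := 1) (t' := 0) (s := 0)
      (by rwa [upper_zero]) (by rw [upper_zero, upper_zero]; exact H.one_mem))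
  obtain ⟨g, hg⟩ := exists_conjGL_eq_upper_one (trace_eq_two_of_pow_char p hyp) hy1
  exact ⟨g⁻¹, by rwa [← hg, conjGL_inv_conjGL]⟩

lemma exists_upper_mem (hH : IsCentralSubdirect H) (p : ℕ) [Fact p.Prime] [CharP F p]
    [CharP F' p] (h1 : (upper 1, upper 1) ∈ H) (t : F) : ∃ s, (upper t, upper s) ∈ H := by
  obtain ⟨y, hy, hyp⟩ := hH.exists_pow_char_eq_one p (upper_pow_char p t)
  have htr := trace_eq_two_of_pow_char p hyp
  have hdet := det_entries y
  suffices y 1 0 = 0 ∧ y 0 0 = y 1 1 by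
    obtain ⟨hc, had⟩ := this
    have hd : y 1 1 = 1 := by
      rw [hc, had] at hdet
      have : (y 1 1 - 1) ^ 2 = 0 := by linear_combination hdet - htr + had
      exact sub_eq_zero.1 (pow_eq_zero_iff two_ne_zero |>.1 this)
    refine ⟨y 0 1, ?_⟩
    convert hy
    apply ext_entries <;> simp [hc, hd, had]
  have hcomm := hH.mul_upper_eq_or (x := upper t)
    (by rw [← upper_add, ← upper_add, add_comm]) hy h1 h1
  rcases hcomm with h | h
  · have h₀₀ := congr($h 0 0)
    have h₀₁ := congr($h 0 1)
    simp [Matrix.mul_apply] at h₀₀ h₀₁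
    exact ⟨h₀₀, by linear_combination h₀₁⟩
  · have h₀₀ := congr($h 0 0)
    have h₁₀ := congr($h 1 0)
    have h₁₁ := congr($h 1 1)
    simp only [coe_mul, coe_neg, Matrix.neg_apply, Matrix.mul_apply, Fin.sum_univ_two]
      at h₀₀ h₁₀ h₁₁
    simp at h₀₀ h₁₀ h₁₁
    have h2 : (2 : F') = 0 :=
      mul_self_eq_zero.1 (by linear_combination -2 * htr + h₀₀ + h₁₁ - h₁₀)
    exact ⟨by linear_combination h₀₀ - y 0 0 * h2, by linear_combination htr + (1 - y 1 1) * h2⟩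

lemma apply_one_zero_ne_zero (hH : IsCentralSubdirect H) (p : ℕ) [Fact p.Prime] [CharP F p]
    [CharP F' p] (h1 : (upper 1, upper 1) ∈ H) {z : SL(2, F')} (hz : (weyl F, z) ∈ H) :
    z 1 0 ≠ 0 := by
  intro hc
  have hdet := det_entries z
  rw [hc, mul_zero, sub_zero] at hdet
  obtain ⟨t, ht⟩ := hH.swap.exists_upper_mem p h1 (z 0 0 ^ 2)
  have hconj := mul_mem (mul_mem hz h1) (inv_mem hz)
  have : z * upper 1 * z⁻¹ = upper (z 0 0 ^ 2) := by
    rw [mul_inv_eq_iff_eq_mul]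
    apply ext_entries <;> simp [Matrix.mul_apply, hc]
    linear_combination (-z 0 0) * hdet
  rw [this] at hconj
  have h := hH.swap.snd_eq_or_eq_neg (x := upper (z 0 0 ^ 2)) hconj ht
  rw [mul_inv_eq_iff_eq_mul, mul_inv_eq_iff_eq_mul, neg_mul] at h
  rcases h with h | h
  · simpa [Matrix.mul_apply] using congr($h 1 1)
  · simpa [Matrix.mul_apply] using congr($h 1 1)

lemma eq_weyl_or_eq_neg_weyl (hH : IsCentralSubdirect H) (h1 : (upper 1, upper 1) ∈ H)
    {z : SL(2, F')} (hz : (weyl F, z) ∈ H) (h₀ : z 0 0 = 0) : z = weyl F' ∨ z = -weyl F' := by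
  have hdet := det_entries z
  rw [h₀, zero_mul, zero_sub] at hdet
  have hd : z 1 1 = 0 := by
    have hcomm := hH.mul_upper_eq_or (x := weyl F * weyl F) (t := 1) (t' := 1)
      (by apply ext_entries <;> simp [Matrix.mul_apply]) (mul_mem hz hz) h1 h1
    have hc : z 1 0 ≠ 0 := fun hc ↦ by simp [hc] at hdet
    rcases hcomm with h | h
    · have h₀₀ := congr($h 0 0)
      simp only [coe_mul, Matrix.mul_apply, Fin.sum_univ_two] at h₀₀
      simp [h₀, hc] at h₀₀
      exact h₀₀
    · have h₀₀ := congr($h 0 0)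
      have h₁₀ := congr($h 1 0)
      have h₁₁ := congr($h 1 1)
      simp only [coe_mul, coe_neg, Matrix.neg_apply, Matrix.mul_apply, Fin.sum_univ_two]
        at h₀₀ h₁₀ h₁₁
      simp [h₀] at h₀₀ h₁₀ h₁₁
      grind
  have hcube : (weyl F * upper 1) * (weyl F * upper 1) * (weyl F * upper 1) = 1 := by
    apply ext_entries <;> simp [Matrix.mul_apply]
  have hzu := mul_mem hz h1
  have h := hH.snd_central _ (hcube ▸ mul_mem (mul_mem hzu hzu) hzu)
  have hb : z 0 1 = - z 1 0 := by
    rcases h with h | h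
    · have h₀₁ := congr($h 0 1)
      simp only [coe_mul, Matrix.mul_apply, Fin.sum_univ_two] at h₀₁
      simp [h₀, hd] at h₀₁
      grind
    · have h₀₁ := congr($h 0 1)
      simp only [coe_mul, coe_neg, Matrix.neg_apply, Matrix.mul_apply, Fin.sum_univ_two] at h₀₁
      simp [h₀, hd] at h₀₁
      grind
  have hc : z 1 0 ^ 2 = 1 := by rw [hb] at hdet; linear_combination hdet
  refine (sq_eq_one_iff.1 hc).symm.imp (fun hc ↦ ?_) fun hc ↦ ?_
  · apply ext_entries <;> simp [h₀, hd, hb, hc]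
  · apply ext_entries <;> simp [h₀, hd, hb, hc]

lemma exists_normalized (hH : IsCentralSubdirect H) (p : ℕ) [Fact p.Prime] [CharP F p]
    [CharP F' p] : ∃ g : GL (Fin 2) F', (upper 1, conjGL g (upper 1)) ∈ H ∧
      ((weyl F, conjGL g (weyl F')) ∈ H ∨ (weyl F, conjGL g (-weyl F')) ∈ H) := by
  obtain ⟨g, hg⟩ := hH.exists_conj_upper_one p
  have hH₁ := hH.comap_conjGL g
  obtain ⟨z, hz⟩ := hH₁.fst_surjective (weyl F)
  have hc := hH₁.apply_one_zero_ne_zero p hg hz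
  let s : SL(2, F') := upper (z 0 0 / z 1 0)
  have hs : conjGL (toGL s) (upper 1) = upper 1 := by
    rw [conjGL_toGL, mul_inv_eq_iff_eq_mul, ← upper_add, ← upper_add, add_comm]
  have hH₂ := hH₁.comap_conjGL (toGL s)
  have h1 : (upper 1, conjGL g (conjGL (toGL s) (upper 1))) ∈ H := by rwa [hs]
  have hz' : (weyl F, conjGL g (conjGL (toGL s) (s⁻¹ * z * s))) ∈ H := by
    rw [conjGL_toGL, show s * (s⁻¹ * z * s) * s⁻¹ = z by group]
    exact hz
  refine ⟨g * toGL s, by rwa [conjGL_mul], ?_⟩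
  rw [conjGL_mul, conjGL_mul]
  have := hH₂.eq_weyl_or_eq_neg_weyl h1 (z := s⁻¹ * z * s) hz' (by
    simp only [s, upper_inv, coe_mul, Matrix.mul_apply, Fin.sum_univ_two]
    simp [hc])
  exact this.imp (fun h ↦ by rwa [← h]) fun h ↦ by rwa [← h]

lemma map_sq_mul (hH : IsCentralSubdirect H) {α : F → F'} (h1 : α 1 ≠ 0)
    (hα : ∀ t, (upper t, upper (α t)) ∈ H)
    (hw : (weyl F, weyl F') ∈ H ∨ (weyl F, -weyl F') ∈ H) {s : F} (hs : s ≠ 0) (r : F) :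
    α (s ^ 2 * r) = α s ^ 2 * α r := by
  have hD : ∀ r, weyl F * upper s⁻¹ * (weyl F * upper s) * (weyl F * upper s⁻¹) * upper r =
      upper (s ^ 2 * r) * (weyl F * upper s⁻¹ * (weyl F * upper s) * (weyl F * upper s⁻¹)) := by
    intro r
    apply ext_entries <;> simp [Matrix.mul_apply, hs]
    field_simp
  set E : SL(2, F') := weyl F' * upper (α s⁻¹) * (weyl F' * upper (α s)) *
    (weyl F' * upper (α s⁻¹)) with hE
  have hcomm : ∀ r, E * upper (α r) = upper (α (s ^ 2 * r)) * E ∨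
      E * upper (α r) = -(upper (α (s ^ 2 * r)) * E) := by
    intro r
    rcases hw with hw | hw
    · exact hH.mul_upper_eq_or (hD r) (mul_mem (mul_mem (mul_mem hw (hα _))
        (mul_mem hw (hα _))) (mul_mem hw (hα _))) (hα _) (hα _)
    · have := hH.mul_upper_eq_or (hD r) (mul_mem (mul_mem (mul_mem hw (hα _))
        (mul_mem hw (hα _))) (mul_mem hw (hα _))) (hα r) (hα (s ^ 2 * r))
      simpa only [hE, neg_mul, mul_neg, neg_neg, neg_inj, neg_eq_iff_eq_neg] using this
  have h₀₀ : E 0 0 = α s := by simp [hE, Matrix.mul_apply]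
  have h₀₁ : E 0 1 = α s * α s⁻¹ - 1 := by simp [hE, Matrix.mul_apply]; ring
  have h₁₀ : E 1 0 = 1 - α s * α s⁻¹ := by simp [hE, Matrix.mul_apply]; ring
  have h₁₁ : E 1 1 = 2 * α s⁻¹ - α s⁻¹ ^ 2 * α s := by simp [hE, Matrix.mul_apply]; ring
  have hab : α s * α s⁻¹ = 1 := by
    rcases hcomm 1 with h | h
    · have e₁ := congr($h 1 1)
      simp only [coe_mul, Matrix.mul_apply, Fin.sum_univ_two, h₀₁, h₁₀, h₁₁] at e₁
      simp [h1] at e₁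
      linear_combination -e₁
    · have e₀ := congr($h 1 0)
      have e₁ := congr($h 1 1)
      simp only [coe_mul, coe_neg, Matrix.neg_apply, Matrix.mul_apply, Fin.sum_univ_two,
        h₀₀, h₀₁, h₁₀, h₁₁] at e₀ e₁
      simp at e₀ e₁
      have : (1 - α s * α s⁻¹) ^ 2 * α 1 = 0 := by
        linear_combination (1 - α s * α s⁻¹) * e₁ - (2 * α s⁻¹ - α s⁻¹ ^ 2 * α s) * e₀
      have := pow_eq_zero_iff two_ne_zero |>.1 ((mul_eq_zero.1 this).resolve_right h1)
      linear_combination -this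
  rcases hcomm r with h | h
  · have e₀ := congr($h 0 1)
    simp only [coe_mul, Matrix.mul_apply, Fin.sum_univ_two, h₀₀, h₀₁, h₁₁] at e₀
    simp [hab] at e₀
    linear_combination -α s * e₀ + α (s ^ 2 * r) * (α s * α s⁻¹ - 1) * hab
  · have e₀ := congr($h 0 1)
    have e₁ := congr($h 0 0)
    simp only [coe_mul, coe_neg, Matrix.neg_apply, Matrix.mul_apply, Fin.sum_univ_two,
      h₀₀, h₀₁, h₁₀, h₁₁] at e₀ e₁
    simp [hab] at e₀ e₁
    linear_combination α s * e₀ + α (s ^ 2 * r) * (α s * α s⁻¹ - 1) * hab - α s * α r * e₁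

lemma exists_ringEquiv [Finite F] (hH : IsCentralSubdirect H) (p : ℕ) [Fact p.Prime] [CharP F p]
    [CharP F' p] (h1 : (upper 1, upper 1) ∈ H)
    (hw : (weyl F, weyl F') ∈ H ∨ (weyl F, -weyl F') ∈ H) :
    ∃ e : F ≃+* F', ∀ t, (upper t, upper (e t)) ∈ H := by
  choose α hα using hH.exists_upper_mem p h1
  have huniq {t : F} {s : F'} (h : (upper t, upper s) ∈ H) : α t = s :=
    hH.swap.eq_of_upper_mem (hα t) h
  have map_one : α 1 = 1 := huniq h1
  have map_zero : α 0 = 0 := huniq (by rw [upper_zero, upper_zero]; exact H.one_mem)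
  have map_add (s t : F) : α (s + t) = α s + α t :=
    huniq (by rw [upper_add, upper_add]; exact mul_mem (hα s) (hα t))
  have map_sq_mul' (s r : F) : α (s ^ 2 * r) = α s ^ 2 * α r := by
    rcases eq_or_ne s 0 with rfl | hs
    · simp [map_zero]
    · exact hH.map_sq_mul (map_one ▸ one_ne_zero) hα hw hs r
  have map_sq (s : F) : α (s ^ 2) = α s ^ 2 := by simpa [map_one] using map_sq_mul' s 1
  have map_mul (s t : F) : α (s * t) = α s * α t := by
    by_cases h2 : (2 : F) = 0
    · have := CharTwo.of_one_ne_zero_of_two_eq_zero one_ne_zero h2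
      obtain ⟨r, rfl⟩ := FiniteField.isSquare_of_char_two (ringChar.eq F 2) s
      rw [← sq, map_sq_mul', map_sq]
    · have hst : s * t + ((s - 1) / 2) ^ 2 * t = ((s + 1) / 2) ^ 2 * t := by field_simp; ring
      have hs' : s + ((s - 1) / 2) ^ 2 = ((s + 1) / 2) ^ 2 := by field_simp; ring
      have e := congr(α $hst)
      have e' := congr(α $hs')
      rw [map_add, map_sq_mul', map_sq_mul'] at e
      rw [map_add, map_sq, map_sq] at e'
      linear_combination e - α t * e'
  let f : F →+* F' :=
    { toFun := α, map_one' := map_one, map_mul' := map_mul, map_zero' := map_zero,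
      map_add' := map_add }
  have hsurj : Function.Surjective f := fun s ↦ by
    obtain ⟨t, ht⟩ := hH.swap.exists_upper_mem p h1 s
    exact ⟨t, huniq ht⟩
  exact ⟨RingEquiv.ofBijective f ⟨f.injective, hsurj⟩, hα⟩

lemma map_mem [Fintype F] (hF : 4 ≤ Fintype.card F) (e : F →+* F')
    (he : ∀ t, (upper t, upper (e t)) ∈ H)
    (hw : (weyl F, weyl F') ∈ H ∨ (weyl F, -weyl F') ∈ H) (x : SL(2, F)) : (x, map e x) ∈ H := by
  have hsign (x : SL(2, F)) : (x, map e x) ∈ H ∨ (x, -map e x) ∈ H := by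
    refine upper_generate (fun x ↦ (x, map e x) ∈ H ∨ (x, -map e x) ∈ H)
      (fun t ↦ Or.inl ?_) ?_ (fun x y hx hy ↦ ?_) x
    · convert he t
      apply ext_entries <;> simp
    · have : map e (weyl F) = weyl F' := by apply ext_entries <;> simp
      rwa [this]
    · rw [_root_.map_mul]
      rcases hx with hx | hx <;> rcases hy with hy | hy
      · exact Or.inl (mul_mem hx hy)
      · exact Or.inr (by simpa using mul_mem hx hy)
      · exact Or.inr (by simpa using mul_mem hx hy)
      · exact Or.inl (by simpa using mul_mem hx hy)
  have neg_inv' (y : SL(2, F')) : (-y)⁻¹ = -y⁻¹ := by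
    rw [inv_eq_iff_mul_eq_one, neg_mul_neg, mul_inv_cancel]
  have htop : H.comap ((MonoidHom.id _).prod (map e)) = ⊤ :=
    eq_top_of_forall_commutator_mem hF fun x y ↦ by
      simp only [Subgroup.mem_comap, MonoidHom.prod_apply, MonoidHom.id_apply, _root_.map_mul,
        _root_.map_inv]
      rcases hsign x with hx | hx <;> rcases hsign y with hy | hy <;>
        simpa [neg_inv'] using mul_mem (mul_mem (mul_mem hx hy) (inv_mem hx)) (inv_mem hy)
  exact (htop ▸ Subgroup.mem_top x : x ∈ H.comap ((MonoidHom.id _).prod (map e)))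

lemma mem_iff_of_map_mem (hH : IsCentralSubdirect H) {f : SL(2, F) →* SL(2, F')}
    (hf : ∀ x, (x, f x) ∈ H) :
    (∀ x y, (x, y) ∈ H ↔ y = f x) ∨ ∀ x y, (x, y) ∈ H ↔ y = f x ∨ y = -f x := by
  by_cases hneg : (1, -1) ∈ H
  · refine Or.inr fun x y ↦ ⟨fun h ↦ hH.snd_eq_or_eq_neg h (hf x), ?_⟩
    rintro (rfl | rfl)
    · exact hf x
    · simpa using mul_mem hneg (hf x)
  · refine Or.inl fun x y ↦ ⟨fun h ↦ ?_, fun h ↦ h ▸ hf x⟩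
    refine (hH.snd_eq_or_eq_neg h (hf x)).resolve_right ?_
    rintro rfl
    exact hneg (by simpa using mul_mem h (inv_mem (hf x)))

end IsCentralSubdirect

lemma eq_top_or_isCentralSubdirect {F F' : Type*} [Field F] [Field F'] [Fintype F] [Fintype F']
    (hF : 4 ≤ Fintype.card F) (hF' : 4 ≤ Fintype.card F') {H : Subgroup (SL(2, F) × SL(2, F'))}
    (h₁ : ∀ x, ∃ y, (x, y) ∈ H) (h₂ : ∀ y, ∃ x, (x, y) ∈ H) : H = ⊤ ∨ IsCentralSubdirect H := by
  have hn₁ : H.goursatFst.Normal := Subgroup.normal_goursatFst fun x ↦ by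
    obtain ⟨y, hy⟩ := h₁ x
    exact ⟨⟨_, hy⟩, rfl⟩
  have hn₂ : H.goursatSnd.Normal := Subgroup.normal_goursatSnd fun y ↦ by
    obtain ⟨x, hx⟩ := h₂ y
    exact ⟨⟨_, hx⟩, rfl⟩
  rcases normal_eq_top_or_central hF H.goursatFst with h | hc₁
  · refine Or.inl (Subgroup.eq_top_iff' H |>.2 fun ⟨x, y⟩ ↦ ?_)
    obtain ⟨x', hx'⟩ := h₂ y
    have := Subgroup.mem_goursatFst.1 (h ▸ Subgroup.mem_top (x * x'⁻¹))
    simpa using H.mul_mem this hx'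
  rcases normal_eq_top_or_central hF' H.goursatSnd with h | hc₂
  · refine Or.inl (Subgroup.eq_top_iff' H |>.2 fun ⟨x, y⟩ ↦ ?_)
    obtain ⟨y', hy'⟩ := h₁ x
    have := Subgroup.mem_goursatSnd.1 (h ▸ Subgroup.mem_top (y * y'⁻¹))
    simpa using H.mul_mem this hy'
  exact Or.inr ⟨h₁, h₂, fun x hx ↦ hc₁ x (Subgroup.mem_goursatFst.2 hx),
    fun y hy ↦ hc₂ y (Subgroup.mem_goursatSnd.2 hy)⟩

end SL2Goursat

/-- (Goursat for `SL₂` of finite fields.)  If `H ≤ SL(2,F) × SL(2,F')`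
surjects onto both factors, with `F, F'` finite fields of the same characteristic and
cardinality at least 4, then either `H` is everything, or — after conjugating by a pair of
invertible matrices — `H` is the graph of the isomorphism induced by a field isomorphism
`e : F ≅ F'`, or the "±graph" of such an isomorphism. -/
theorem stmt11 (F F' : Type*) [Field F] [Field F'] [Fintype F] [Fintype F']
    (hchar : ringChar F = ringChar F')
    (h4 : 4 ≤ Fintype.card F) (h4' : 4 ≤ Fintype.card F')
    (H : Subgroup (Matrix.SpecialLinearGroup (Fin 2) F ×
      Matrix.SpecialLinearGroup (Fin 2) F'))
    (hsurj₁ : ∀ x : Matrix.SpecialLinearGroup (Fin 2) F, ∃ y, (x, y) ∈ H)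
    (hsurj₂ : ∀ y : Matrix.SpecialLinearGroup (Fin 2) F', ∃ x, (x, y) ∈ H) :
    H = ⊤ ∨
      ∃ (e : F ≃+* F') (g₁ : GL (Fin 2) F) (g₂ : GL (Fin 2) F'),
        (∀ (x : Matrix.SpecialLinearGroup (Fin 2) F)
            (y : Matrix.SpecialLinearGroup (Fin 2) F'),
          (x, y) ∈ H ↔
            (g₂ : Matrix (Fin 2) (Fin 2) F') * (y : Matrix (Fin 2) (Fin 2) F') *
                ((g₂⁻¹ : GL (Fin 2) F') : Matrix (Fin 2) (Fin 2) F') =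
              ((g₁ : Matrix (Fin 2) (Fin 2) F) * (x : Matrix (Fin 2) (Fin 2) F) *
                ((g₁⁻¹ : GL (Fin 2) F) : Matrix (Fin 2) (Fin 2) F)).map e) ∨
        (∀ (x : Matrix.SpecialLinearGroup (Fin 2) F)
            (y : Matrix.SpecialLinearGroup (Fin 2) F'),
          (x, y) ∈ H ↔
            ((g₂ : Matrix (Fin 2) (Fin 2) F') * (y : Matrix (Fin 2) (Fin 2) F') *
                ((g₂⁻¹ : GL (Fin 2) F') : Matrix (Fin 2) (Fin 2) F') =
              ((g₁ : Matrix (Fin 2) (Fin 2) F) * (x : Matrix (Fin 2) (Fin 2) F) *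
                ((g₁⁻¹ : GL (Fin 2) F) : Matrix (Fin 2) (Fin 2) F)).map e ∨
            (g₂ : Matrix (Fin 2) (Fin 2) F') * (y : Matrix (Fin 2) (Fin 2) F') *
                ((g₂⁻¹ : GL (Fin 2) F') : Matrix (Fin 2) (Fin 2) F') =
              -((g₁ : Matrix (Fin 2) (Fin 2) F) * (x : Matrix (Fin 2) (Fin 2) F) *
                ((g₁⁻¹ : GL (Fin 2) F) : Matrix (Fin 2) (Fin 2) F)).map e)) := by
  rcases SL2Goursat.eq_top_or_isCentralSubdirect h4 h4' hsurj₁ hsurj₂ with hH | hH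
  · exact Or.inl hH
  right
  have : CharP F' (ringChar F) := hchar ▸ ringChar.charP F'
  have : Fact (ringChar F).Prime := ⟨CharP.char_is_prime F _⟩
  obtain ⟨g, h1, hw⟩ := hH.exists_normalized (ringChar F)
  have hH' := hH.comap_conjGL g
  obtain ⟨e, he⟩ := hH'.exists_ringEquiv (ringChar F) h1 hw
  have hmem (x : Matrix.SpecialLinearGroup (Fin 2) F) (y : Matrix.SpecialLinearGroup (Fin 2) F') :
      (x, y) ∈ H ↔ (x, SL2Goursat.conjGL g⁻¹ y) ∈
        H.comap ((MonoidHom.id _).prodMap (SL2Goursat.conjGL g)) := by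
    simp [SL2Goursat.conjGL_conjGL_inv]
  refine ⟨e, 1, g⁻¹, ?_⟩
  simp only [inv_one, Units.val_one, one_mul, mul_one]
  have hmap := SL2Goursat.IsCentralSubdirect.map_mem h4 (e : F →+* F') he hw
  refine (hH'.mem_iff_of_map_mem hmap).imp (fun h x y ↦ ?_) fun h x y ↦ ?_
  · exact (hmem x y).trans <| (h x _).trans Subtype.ext_iff
  · exact (hmem x y).trans <| (h x _).trans <| or_congr Subtype.ext_iff Subtype.ext_iff
end

section
/- Let p ≥ 5 be a prime and let F, F' be finite fields of characteristic p. Let W(F) and W(F') denote the rings of p-typical Witt vectors of F and F', and for n ≥ 1 let Wₙ(F) denote the ring of length-n truncated Witt vectors, with the truncation ring homomorphism W(F) → Wₙ(F) inducing a group homomorphism SL(2, W(F)) → SL(2, Wₙ(F)) by applying it entrywise. Let H be a subgroup of SL(2, W(F)) × SL(2, W(F')) such that the image of H in SL(2, W₁(F)) × SL(2, W₁(F')) under entrywise truncation is the whole group. Then for every n ≥ 1, the image of H in SL(2, Wₙ(F)) × SL(2, Wₙ(F')) is all of SL(2, Wₙ(F)) × SL(2, Wₙ(F')). -/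
open Matrix

theorem mul_natCast_pow_comm {R : Type*} [Ring R] (p k : ℕ) (y : R) :
    y * (p : R) ^ k = (p : R) ^ k * y :=
  ((Nat.cast_commute p y).pow_left k).eq.symm

/-- If `u ^ 2 = 0` and `x ≡ 1 + p ^ n u` modulo `p ^ (n + 1)`, then
`x ^ p ≡ 1 + p ^ (n + 1) u` modulo `p ^ (n + 2)`. -/
theorem pow_dvd_pow_prime_sub_one_add {R : Type*} [Ring R] {p : ℕ} (hp : p.Prime) (hp5 : 5 ≤ p)
    {n : ℕ} {x u : R} (hu : u * u = 0)
    (hx : (p : R) ^ (n + 1) ∣ x - (1 + (p : R) ^ n * u)) :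
    (p : R) ^ (n + 2) ∣ x ^ p - (1 + (p : R) ^ (n + 1) * u) := by
  obtain ⟨z, hz⟩ := hx
  set w : R := (p : R) ^ n * (u + p * z) with hw
  have hxw : x = w + 1 := by
    rw [eq_add_of_sub_eq hz, hw, pow_succ]
    noncomm_ring
  have hyy : (u + p * z) * (u + p * z) = p * (u * z + z * u + p * (z * z)) := by
    have h1 : u * (p * z) = p * (u * z) := by rw [← mul_assoc, ← Nat.cast_comm, mul_assoc]
    have h2 : z * (p * z) = p * (z * z) := by rw [← mul_assoc, ← Nat.cast_comm, mul_assoc]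
    simp only [mul_add, add_mul, hu, h1, mul_assoc, h2]
    abel
  have hww : w ^ 2 = (p : R) ^ (2 * n + 1) * (u * z + z * u + p * (z * z)) := by
    rw [sq, hw, mul_assoc, ← mul_assoc (u + p * z), mul_natCast_pow_comm, mul_assoc, hyy,
      pow_succ, two_mul, pow_add]
    simp only [mul_assoc]
  have hw2 : (p : R) ^ (n + 1) ∣ w ^ 2 := by
    rw [hww]; exact (pow_dvd_pow _ (by lia)).mul_right _
  have hw4 : (p : R) ^ (n + 2) ∣ w ^ 4 := by
    rw [show 4 = 2 + 2 by rfl, pow_add w, hww, mul_assoc, ← mul_assoc _ ((p : R) ^ _), mul_natCast_pow_comm,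
      mul_assoc, ← mul_assoc, ← pow_add]
    exact (pow_dvd_pow _ (by lia)).mul_right _
  have hlin : (p : R) ^ (n + 2) ∣ w * p - (p : R) ^ (n + 1) * u := by
    refine ⟨z, ?_⟩
    rw [← Nat.cast_comm, hw, ← mul_assoc, ← pow_succ', mul_add, ← mul_assoc, ← pow_succ]
    abel
  obtain ⟨q, rfl⟩ : ∃ q, p = q + 2 := ⟨p - 2, by lia⟩
  have hexp : x ^ (q + 2) - (1 + ((q + 2 : ℕ) : R) ^ (n + 1) * u) =
      (∑ k ∈ Finset.range q, w ^ (k + 2) * ((q + 2).choose (k + 2) : R)) + w ^ (q + 2) +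
        (w * ((q + 2 : ℕ) : R) - ((q + 2 : ℕ) : R) ^ (n + 1) * u) := by
    rw [hxw, (Commute.one_right w).add_pow, Finset.sum_range_succ, Finset.sum_range_succ',
      Finset.sum_range_succ']
    simp
    abel
  rw [hexp]
  refine dvd_add (dvd_add (Finset.dvd_sum fun k hk => ?_) ?_) hlin
  · obtain ⟨c, hcc⟩ := hp.dvd_choose_self (k := k + 2) (by lia)
      (by have := Finset.mem_range.mp hk; lia)
    rw [hcc, ← Nat.cast_comm, Nat.cast_mul, mul_assoc, pow_succ' _ (n + 1), Nat.cast_comm c,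
      add_comm k 2, pow_add w, mul_assoc (w ^ 2)]
    exact mul_dvd_mul_left _ (hw2.mul_right _)
  · rw [show q + 2 = 4 + (q - 2) by lia, pow_add w]
    rw [show 4 + (q - 2) = q + 2 by lia]
    exact hw4.mul_right _

/-- Products of elements congruent to `1 + p ^ n u` and `1 + p ^ n v` modulo `p ^ (n + 1)`
are congruent to `1 + p ^ n (u + v)`, for `n ≥ 1`. -/
theorem pow_dvd_mul_sub_one_add {R : Type*} [Ring R] {p n : ℕ} {x y u v : R}
    (hx : (p : R) ^ (n + 2) ∣ x - (1 + (p : R) ^ (n + 1) * u))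
    (hy : (p : R) ^ (n + 2) ∣ y - (1 + (p : R) ^ (n + 1) * v)) :
    (p : R) ^ (n + 2) ∣ x * y - (1 + (p : R) ^ (n + 1) * (u + v)) := by
  set b : R := 1 + (p : R) ^ (n + 1) * v with hb
  have hdec : x * y - (1 + (p : R) ^ (n + 1) * (u + v)) =
      (x - (1 + (p : R) ^ (n + 1) * u)) * b + x * (y - b) +
        (p : R) ^ (n + 1) * (u * (p : R) ^ (n + 1) * v) := by
    rw [hb]; noncomm_ring
  rw [hdec]
  refine dvd_add (dvd_add (hx.mul_right _) ?_) ?_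
  · obtain ⟨c, h⟩ := hy
    rw [h, ← mul_assoc, mul_natCast_pow_comm, mul_assoc]
    exact dvd_mul_right _ _
  · rw [mul_natCast_pow_comm, mul_assoc, ← mul_assoc, ← pow_add]
    exact (pow_dvd_pow _ (by lia)).mul_right _

/-- Lifting generation from level `p` to level `p ^ (n + 1)`, when the successive congruence
kernels are spanned by square-zero elements. -/
theorem Subgroup.exists_mem_pow_dvd_sub {G R : Type*} [Group G] [Ring R] (φ : G →* R) {p : ℕ}
    (hp : p.Prime) (hp5 : 5 ≤ p) (H : Subgroup G)
    (hker : ∀ (n : ℕ) (g : G), (p : R) ^ (n + 1) ∣ φ g - 1 → ∃ u : Fin 3 → R,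
      (∀ i, u i * u i = 0) ∧ (∀ i, ∃ g', φ g' = 1 + u i) ∧
        (p : R) ^ (n + 2) ∣ φ g - (1 + (p : R) ^ (n + 1) * (u 0 + u 1 + u 2)))
    (hH : ∀ g, ∃ h ∈ H, (p : R) ∣ φ h - φ g) (n : ℕ) (g : G) :
    ∃ h ∈ H, (p : R) ^ (n + 1) ∣ φ h - φ g := by
  have dvd_left : ∀ (k : ℕ) (x y : R), (p : R) ^ k ∣ y → (p : R) ^ k ∣ x * y := by
    rintro k x y ⟨c, rfl⟩
    rw [← mul_assoc, mul_natCast_pow_comm, mul_assoc]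
    exact dvd_mul_right _ _
  have hsq : ∀ (u : R), u * u = 0 → (∃ g', φ g' = 1 + u) → ∀ k,
      ∃ h ∈ H, (p : R) ^ (k + 1) ∣ φ h - (1 + (p : R) ^ k * u) := by
    rintro u hu ⟨g', hg'⟩ k
    induction k with
    | zero =>
      obtain ⟨h, hh, hd⟩ := hH g'
      exact ⟨h, hh, by simpa [hg'] using hd⟩
    | succ k ih =>
      obtain ⟨h, hh, hd⟩ := ih
      exact ⟨h ^ p, H.pow_mem hh p, by
        rw [map_pow]; exact pow_dvd_pow_prime_sub_one_add hp hp5 hu hd⟩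
  induction n generalizing g with
  | zero => simpa using hH g
  | succ n ih =>
    obtain ⟨h, hh, hd⟩ := ih g
    have hd' : (p : R) ^ (n + 1) ∣ φ (h⁻¹ * g) - 1 := by
      have : φ (h⁻¹ * g) - 1 = φ h⁻¹ * -(φ h - φ g) := by
        rw [map_mul, neg_sub, mul_sub, ← map_mul φ h⁻¹ h, inv_mul_cancel, map_one]
      rw [this]
      exact dvd_left _ _ _ (dvd_neg.mpr hd)
    obtain ⟨u, hu, hu', hdu⟩ := hker n _ hd'
    choose k hk hkd using fun i => hsq (u i) (hu i) (hu' i) (n + 1)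
    refine ⟨h * (k 0 * k 1 * k 2),
      H.mul_mem hh (H.mul_mem (H.mul_mem (hk 0) (hk 1)) (hk 2)), ?_⟩
    have hprod := pow_dvd_mul_sub_one_add (pow_dvd_mul_sub_one_add (hkd 0) (hkd 1)) (hkd 2)
    have : φ (h * (k 0 * k 1 * k 2)) - φ g =
        φ h * (φ (k 0) * φ (k 1) * φ (k 2) - φ (h⁻¹ * g)) := by
      rw [mul_sub, ← map_mul φ h (h⁻¹ * g), mul_inv_cancel_left]
      simp only [map_mul]
    rw [this]
    refine dvd_left _ _ _ ?_
    simpa using dvd_sub hprod hdu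

theorem Matrix.natCast_pow_mul_apply {ι A : Type*} [Fintype ι] [DecidableEq ι] [CommRing A]
    (p k : ℕ) (M : Matrix ι ι A) (i j : ι) :
    ((p : Matrix ι ι A) ^ k * M) i j = (p : A) ^ k * M i j := by
  rw [← Nat.cast_pow, ← nsmul_eq_mul, Matrix.smul_apply, nsmul_eq_mul, Nat.cast_pow]

/-- A matrix is divisible by a natural number iff all its entries are. -/
theorem Matrix.natCast_pow_dvd_iff {ι A : Type*} [Fintype ι] [DecidableEq ι] [CommRing A]
    {p k : ℕ} {M : Matrix ι ι A} :
    (p : Matrix ι ι A) ^ k ∣ M ↔ ∀ i j, (p : A) ^ k ∣ M i j := by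
  constructor
  · rintro ⟨c, rfl⟩ i j
    exact ⟨c i j, natCast_pow_mul_apply p k c i j⟩
  · intro h
    choose c hc using h
    exact ⟨Matrix.of c, by ext i j; rw [natCast_pow_mul_apply, hc]; rfl⟩

/-- An element of `SL₂` congruent to `1` modulo `p ^ (n + 1)` has the form `1 + p ^ (n + 1) m`
modulo `p ^ (n + 2)`, with `m` a sum of three square-zero matrices. -/
theorem Matrix.SpecialLinearGroup.exists_sq_zero_decomposition {A : Type*} [CommRing A]
    [IsDomain A] {p : ℕ} (hp0 : (p : A) ≠ 0) (n : ℕ) (g : SpecialLinearGroup (Fin 2) A)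
    (hg : (p : Matrix (Fin 2) (Fin 2) A) ^ (n + 1) ∣ (g : Matrix (Fin 2) (Fin 2) A) - 1) :
    ∃ u : Fin 3 → Matrix (Fin 2) (Fin 2) A,
      (∀ i, u i * u i = 0) ∧
      (∀ i, ∃ g' : SpecialLinearGroup (Fin 2) A, (g' : Matrix (Fin 2) (Fin 2) A) = 1 + u i) ∧
        (p : Matrix (Fin 2) (Fin 2) A) ^ (n + 2) ∣
          (g : Matrix (Fin 2) (Fin 2) A) -
            (1 + (p : Matrix (Fin 2) (Fin 2) A) ^ (n + 1) * (u 0 + u 1 + u 2)) := by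
  obtain ⟨m, hm⟩ := hg
  have hdet : (p : A) ^ (n + 1) * (m 0 0 + m 1 1 + (p : A) ^ (n + 1) * m.det) = 0 := by
    have h := g.det_coe
    rw [eq_add_of_sub_eq hm, Matrix.det_fin_two] at h
    simp only [Matrix.add_apply, natCast_pow_mul_apply, Matrix.one_apply] at h
    simp at h
    rw [Matrix.det_fin_two]
    linear_combination h
  have htr : m 1 1 = -m 0 0 - (p : A) ^ (n + 1) * m.det := by
    have := (mul_eq_zero.mp hdet).resolve_left (pow_ne_zero _ hp0)
    linear_combination this
  refine ⟨![!![m 0 0, -m 0 0; m 0 0, -m 0 0], !![0, m 0 1 + m 0 0; 0, 0],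
    !![0, 0; m 1 0 - m 0 0, 0]], ?_, ?_, ?_⟩
  · intro i
    fin_cases i <;> ext i j <;> fin_cases i <;> fin_cases j <;> simp
  · intro i
    refine ⟨⟨_, ?_⟩, rfl⟩
    fin_cases i <;> simp [Matrix.det_fin_two]
    ring
  · rw [← sub_sub, hm, ← mul_sub, pow_succ _ (n + 1)]
    refine mul_dvd_mul_left _ ?_
    rw [← pow_one (p : Matrix (Fin 2) (Fin 2) A), Matrix.natCast_pow_dvd_iff]
    intro i j
    fin_cases i <;> fin_cases j <;> simp [htr]
    rw [show -m 0 0 - (p : A) ^ (n + 1) * m.det + m 0 0 = p * (-(p : A) ^ n * m.det) by ring]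
    exact dvd_mul_right _ _

/-- A surjective local homomorphism of commutative rings with local source
induces a surjection on `SL₂`. -/
theorem Matrix.SpecialLinearGroup.map_surjective_of_isLocalRing {A B : Type*} [CommRing A]
    [IsLocalRing A] [CommRing B] (f : A →+* B) [IsLocalHom f] (hf : Function.Surjective f) :
    Function.Surjective (SpecialLinearGroup.map (n := Fin 2) f) := by
  intro g
  choose s hs using hf
  have hdet : g 0 0 * g 1 1 - g 0 1 * g 1 0 = 1 := by
    rw [← Matrix.det_fin_two]; exact g.det_coe
  have hunit : IsUnit (s (g 0 0) * s (g 1 1) + -(s (g 0 1) * s (g 1 0))) := by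
    apply isUnit_of_map_unit f
    simp [hs, ← sub_eq_add_neg, hdet]
  rcases IsLocalRing.isUnit_or_isUnit_of_isUnit_add hunit with h | h
  · obtain ⟨v, hv⟩ := isUnit_iff_exists_inv.mp (isUnit_of_mul_isUnit_left h)
    refine ⟨⟨!![s (g 0 0), s (g 0 1); s (g 1 0), v * (1 + s (g 0 1) * s (g 1 0))], ?_⟩, ?_⟩
    · rw [Matrix.det_fin_two_of]
      linear_combination (1 + s (g 0 1) * s (g 1 0)) * hv
    · have hv' := congrArg f hv
      simp only [map_mul, map_one, hs] at hv'
      refine SpecialLinearGroup.ext _ _ fun i j => ?_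
      change f (!![_, _; _, _] i j) = g i j
      fin_cases i <;> fin_cases j <;> simp [hs]
      linear_combination g 1 1 * hv' - f v * hdet
  · obtain ⟨v, hv⟩ := isUnit_iff_exists_inv.mp
      (isUnit_of_mul_isUnit_left (IsUnit.neg_iff _ |>.mp h))
    refine ⟨⟨!![s (g 0 0), s (g 0 1); v * (s (g 0 0) * s (g 1 1) - 1), s (g 1 1)], ?_⟩, ?_⟩
    · rw [Matrix.det_fin_two_of]
      linear_combination (1 - s (g 0 0) * s (g 1 1)) * hv
    · have hv' := congrArg f hv
      simp only [map_mul, map_one, hs] at hv'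
      refine SpecialLinearGroup.ext _ _ fun i j => ?_
      change f (!![_, _; _, _] i j) = g i j
      fin_cases i <;> fin_cases j <;> simp [hs]
      linear_combination g 1 0 * hv' + f v * hdet

namespace WittVector

variable {p : ℕ} [hp : Fact p.Prime] {k : Type*} [Field k] [CharP k p]

theorem isLocalHom_truncate {n : ℕ} (hn : 1 ≤ n) :
    IsLocalHom (truncate n : WittVector p k →+* TruncatedWittVector p n k) where
  map_nonunit x hx := by
    refine isUnit_of_coeff_zero_ne_zero x fun h0 => ?_
    obtain ⟨y, hy⟩ := isUnit_iff_exists_inv.mp hx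
    obtain ⟨y, rfl⟩ := truncate_surjective p n k y
    rw [← map_mul, ← sub_eq_zero, ← map_one (truncate n), ← map_sub, ← RingHom.mem_ker,
      mem_ker_truncate] at hy
    have h := hy 0 hn
    rw [← constantCoeff_apply, map_sub, map_mul, map_one, constantCoeff_apply, h0] at h
    simp at h

variable [PerfectRing k p]

theorem truncate_eq_truncate_iff {n : ℕ} {x y : WittVector p k} :
    truncate n x = truncate n y ↔ (p : WittVector p k) ^ n ∣ x - y := by
  rw [← sub_eq_zero, ← map_sub, ← RingHom.mem_ker, mem_ker_truncate,
    ← mem_span_p_pow_iff_le_coeff_eq_zero, Ideal.mem_span_singleton]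

theorem map_truncate_eq_iff {n : ℕ} {g h : SpecialLinearGroup (Fin 2) (WittVector p k)} :
    SpecialLinearGroup.map (truncate n) g = SpecialLinearGroup.map (truncate n) h ↔
      (p : Matrix (Fin 2) (Fin 2) (WittVector p k)) ^ n ∣
        (g : Matrix (Fin 2) (Fin 2) (WittVector p k)) - h := by
  rw [Matrix.natCast_pow_dvd_iff]
  refine (Matrix.SpecialLinearGroup.ext_iff _ _).trans ?_
  simp only [Matrix.sub_apply, ← truncate_eq_truncate_iff]
  rfl

end WittVector

/-- Let `p ≥ 5` be prime and `F, F'` finite fields of characteristic `p`.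
If a subgroup `H ≤ SL(2, W(F)) × SL(2, W(F'))` surjects onto
`SL(2, W₁(F)) × SL(2, W₁(F'))` (the residue level), then it surjects onto
`SL(2, Wₙ(F)) × SL(2, Wₙ(F'))` for every `n ≥ 1`. -/
theorem stmt12 (p : ℕ) [hp : Fact p.Prime] (hp5 : 5 ≤ p)
    (F F' : Type*) [Field F] [Fintype F] [CharP F p] [Field F'] [Fintype F'] [CharP F' p]
    (H : Subgroup (Matrix.SpecialLinearGroup (Fin 2) (WittVector p F) ×
      Matrix.SpecialLinearGroup (Fin 2) (WittVector p F')))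
    (h1 : Subgroup.map
        ((Matrix.SpecialLinearGroup.map (WittVector.truncate 1)).prodMap
          (Matrix.SpecialLinearGroup.map (WittVector.truncate 1))) H = ⊤) :
    ∀ n : ℕ, 1 ≤ n →
      Subgroup.map
        ((Matrix.SpecialLinearGroup.map (WittVector.truncate n)).prodMap
          (Matrix.SpecialLinearGroup.map (WittVector.truncate n))) H = ⊤ := by
  intro n hn
  let φ := (SpecialLinearGroup.coeMonoidHom (ι := Fin 2) (R := WittVector p F)).prodMap
    (SpecialLinearGroup.coeMonoidHom (ι := Fin 2) (R := WittVector p F'))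
  have hiff : ∀ (k : ℕ) (g h : SpecialLinearGroup (Fin 2) (WittVector p F) ×
      SpecialLinearGroup (Fin 2) (WittVector p F')),
      ((SpecialLinearGroup.map (WittVector.truncate k)).prodMap
          (SpecialLinearGroup.map (WittVector.truncate k))) h =
        ((SpecialLinearGroup.map (WittVector.truncate k)).prodMap
          (SpecialLinearGroup.map (WittVector.truncate k))) g ↔
      (p : Matrix (Fin 2) (Fin 2) (WittVector p F) ×
        Matrix (Fin 2) (Fin 2) (WittVector p F')) ^ k ∣ φ h - φ g := by
    intro k g h
    rw [Prod.ext_iff, prod_dvd_iff]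
    exact and_congr WittVector.map_truncate_eq_iff WittVector.map_truncate_eq_iff
  rw [eq_top_iff]
  rintro ⟨g, g'⟩ -
  have := WittVector.isLocalHom_truncate (p := p) (k := F) hn
  have := WittVector.isLocalHom_truncate (p := p) (k := F') hn
  obtain ⟨g, rfl⟩ := SpecialLinearGroup.map_surjective_of_isLocalRing _
    (WittVector.truncate_surjective p n F) g
  obtain ⟨g', rfl⟩ := SpecialLinearGroup.map_surjective_of_isLocalRing _
    (WittVector.truncate_surjective p n F') g'
  obtain ⟨n, rfl⟩ := Nat.exists_eq_add_of_le' hn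
  have hker : ∀ (k : ℕ) (x : SpecialLinearGroup (Fin 2) (WittVector p F) ×
      SpecialLinearGroup (Fin 2) (WittVector p F')),
      (p : Matrix (Fin 2) (Fin 2) (WittVector p F) ×
        Matrix (Fin 2) (Fin 2) (WittVector p F')) ^ (k + 1) ∣ φ x - 1 →
      ∃ u : Fin 3 → Matrix (Fin 2) (Fin 2) (WittVector p F) ×
          Matrix (Fin 2) (Fin 2) (WittVector p F'),
        (∀ i, u i * u i = 0) ∧ (∀ i, ∃ g', φ g' = 1 + u i) ∧
          (p : Matrix (Fin 2) (Fin 2) (WittVector p F) ×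
            Matrix (Fin 2) (Fin 2) (WittVector p F')) ^ (k + 2) ∣
            φ x - (1 + (p : Matrix (Fin 2) (Fin 2) (WittVector p F) ×
              Matrix (Fin 2) (Fin 2) (WittVector p F')) ^ (k + 1) * (u 0 + u 1 + u 2)) := by
    intro k x hx
    rw [prod_dvd_iff] at hx
    obtain ⟨u, hu, hu', hd⟩ := SpecialLinearGroup.exists_sq_zero_decomposition
      (WittVector.p_nonzero p F) k x.1 hx.1
    obtain ⟨v, hv, hv', he⟩ := SpecialLinearGroup.exists_sq_zero_decomposition
      (WittVector.p_nonzero p F') k x.2 hx.2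
    refine ⟨fun i => (u i, v i), fun i => Prod.ext (hu i) (hv i), fun i => ?_,
      prod_dvd_iff.mpr ⟨hd, he⟩⟩
    obtain ⟨a, ha⟩ := hu' i
    obtain ⟨b, hb⟩ := hv' i
    exact ⟨(a, b), Prod.ext ha hb⟩
  obtain ⟨h, hh, hd⟩ := H.exists_mem_pow_dvd_sub φ hp.out hp5 hker (fun x => by
    obtain ⟨h, hh, he⟩ := h1.ge (Subgroup.mem_top (((SpecialLinearGroup.map
      (WittVector.truncate 1)).prodMap (SpecialLinearGroup.map (WittVector.truncate 1))) x))
    exact ⟨h, hh, by simpa only [pow_one] using (hiff 1 x h).mp he⟩) n (g, g')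
  exact ⟨h, hh, (hiff _ (g, g') h).mpr hd⟩
end

section
/- Let p ≥ 5 be a prime, let G = {(x, y) ∈ GL(2, ℤ_p) × GL(2, ℤ_p) : det x = det y}, and let H be a closed subgroup of G (for the p-adic topology) whose projections to both factors GL(2, ℤ_p) are surjective. Then either H = G, or there exists g ∈ GL(2, ℤ/pℤ) such that every (x, y) ∈ H satisfies x̄ = g·ȳ·g⁻¹ or x̄ = −g·ȳ·g⁻¹, where x̄ denotes the matrix obtained from x by reducing each entry modulo p. -/
open Matrix

/-- Entrywise reduction modulo `p` of an element of `GL(2, ℤ_p)`. -/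
noncomputable def redp (p : ℕ) [Fact p.Prime] (x : GL (Fin 2) ℤ_[p]) :
    Matrix (Fin 2) (Fin 2) (ZMod p) :=
  ((x : Matrix (Fin 2) (Fin 2) ℤ_[p])).map (PadicInt.toZMod)

/-- The upper unipotent matrix with off-diagonal entry `r`. -/
def upperUnipotent {R : Type*} [CommRing R] (r : R) : GL (Fin 2) R where
  val := !![1, r; 0, 1]
  inv := !![1, -r; 0, 1]
  val_inv := by simp [Matrix.one_fin_two]
  inv_val := by simp [Matrix.one_fin_two]

/-- The lower unipotent matrix with off-diagonal entry `r`. -/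
def lowerUnipotent {R : Type*} [CommRing R] (r : R) : GL (Fin 2) R where
  val := !![1, 0; r, 1]
  inv := !![1, 0; -r, 1]
  val_inv := by simp [Matrix.one_fin_two]
  inv_val := by simp [Matrix.one_fin_two]

/-- The permutation matrix exchanging the two basis vectors. -/
def swapGL (R : Type*) [CommRing R] : GL (Fin 2) R where
  val := !![0, 1; 1, 0]
  inv := !![0, 1; 1, 0]
  val_inv := by simp [Matrix.one_fin_two]
  inv_val := by simp [Matrix.one_fin_two]

/-- An element of order three of `GL(2, R)`. -/
def orderThreeGL (R : Type*) [CommRing R] : GL (Fin 2) R where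
  val := !![0, -1; 1, -1]
  inv := !![-1, 1; -1, 0]
  val_inv := by simp [Matrix.one_fin_two]
  inv_val := by simp [Matrix.one_fin_two]

theorem orderThreeGL_pow_three (R : Type*) [CommRing R] : orderThreeGL R ^ 3 = 1 := by
  apply Units.ext
  simp [orderThreeGL, pow_succ, Matrix.one_fin_two]

section LocalRing

variable {R : Type*} [CommRing R]

theorem mem_of_unipotent_mem_of_isUnit (N : Subgroup (GL (Fin 2) R))
    (hU : ∀ r : R, upperUnipotent r ∈ N) (hL : ∀ r : R, lowerUnipotent r ∈ N)
    (x : GL (Fin 2) R) (hx : (x : Matrix (Fin 2) (Fin 2) R).det = 1)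
    (hc : IsUnit ((x : Matrix (Fin 2) (Fin 2) R) 1 0)) : x ∈ N := by
  obtain ⟨c', hc'⟩ := hc.exists_right_inv
  have key : x = upperUnipotent (((x : Matrix (Fin 2) (Fin 2) R) 0 0 - 1) * c') *
      lowerUnipotent ((x : Matrix (Fin 2) (Fin 2) R) 1 0) *
      upperUnipotent (((x : Matrix (Fin 2) (Fin 2) R) 1 1 - 1) * c') := by
    apply Units.ext
    rw [Matrix.det_fin_two] at hx
    ext i j
    fin_cases i <;> fin_cases j <;>
      simp [upperUnipotent, lowerUnipotent, Matrix.mul_apply, Fin.sum_univ_two] <;> grind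
  rw [key]
  exact N.mul_mem (N.mul_mem (hU _) (hL _)) (hU _)

variable [IsLocalRing R]

/-- Over a local ring, a subgroup of `GL(2, R)` containing all elementary unipotents contains
`SL(2, R)`. -/
theorem mem_of_unipotent_mem (N : Subgroup (GL (Fin 2) R))
    (hU : ∀ r : R, upperUnipotent r ∈ N) (hL : ∀ r : R, lowerUnipotent r ∈ N)
    (x : GL (Fin 2) R) (hx : (x : Matrix (Fin 2) (Fin 2) R).det = 1) : x ∈ N := by
  by_cases hc : IsUnit ((x : Matrix (Fin 2) (Fin 2) R) 1 0)
  · exact mem_of_unipotent_mem_of_isUnit N hU hL x hx hc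
  rw [← N.mul_mem_cancel_left (hL 1)]
  apply mem_of_unipotent_mem_of_isUnit N hU hL
  · rw [Units.val_mul, Matrix.det_mul, hx]
    simp [lowerUnipotent]
  · have ha : IsUnit ((x : Matrix (Fin 2) (Fin 2) R) 0 0) := by
      rw [Matrix.det_fin_two] at hx
      have h1 : IsUnit ((x : Matrix (Fin 2) (Fin 2) R) 0 0 * (x : Matrix (Fin 2) (Fin 2) R) 1 1 +
          -((x : Matrix (Fin 2) (Fin 2) R) 0 1 * (x : Matrix (Fin 2) (Fin 2) R) 1 0)) := by
        rw [← sub_eq_add_neg, hx]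
        exact isUnit_one
      rcases IsLocalRing.isUnit_or_isUnit_of_isUnit_add h1 with h | h
      · exact isUnit_of_mul_isUnit_left h
      · exact absurd (isUnit_of_mul_isUnit_right (IsUnit.neg_iff _ |>.mp h)) hc
    have h2 : ((lowerUnipotent 1 * x : GL (Fin 2) R) : Matrix (Fin 2) (Fin 2) R) 1 0 =
        (x : Matrix (Fin 2) (Fin 2) R) 0 0 + (x : Matrix (Fin 2) (Fin 2) R) 1 0 := by
      simp [lowerUnipotent, Matrix.mul_apply, Fin.sum_univ_two]
    rw [h2]
    by_contra h
    have h3 : IsUnit (((x : Matrix (Fin 2) (Fin 2) R) 0 0 + (x : Matrix (Fin 2) (Fin 2) R) 1 0) +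
      -(x : Matrix (Fin 2) (Fin 2) R) 1 0) := by simpa using ha
    rcases IsLocalRing.isUnit_or_isUnit_of_isUnit_add h3 with h' | h'
    · exact h h'
    · exact hc (IsUnit.neg_iff _ |>.mp h')

theorem mem_of_normal_of_isUnit_lower (h2 : IsUnit (2 : R)) (h3 : IsUnit (3 : R))
    (N : Subgroup (GL (Fin 2) R)) [N.Normal] (n : GL (Fin 2) R) (hn : n ∈ N)
    (hc : IsUnit ((n : Matrix (Fin 2) (Fin 2) R) 1 0))
    (x : GL (Fin 2) R) (hx : (x : Matrix (Fin 2) (Fin 2) R).det = 1) : x ∈ N := by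
  obtain ⟨i2, hi2⟩ := h2.exists_right_inv
  obtain ⟨i3, hi3⟩ := h3.exists_right_inv
  obtain ⟨c', hc'⟩ := hc.exists_right_inv
  set a := (n : Matrix (Fin 2) (Fin 2) R) 0 0 with ha
  set b := (n : Matrix (Fin 2) (Fin 2) R) 0 1 with hb
  set c := (n : Matrix (Fin 2) (Fin 2) R) 1 0 with hc
  set e := (n : Matrix (Fin 2) (Fin 2) R) 1 1 with he
  have hnm : (n : Matrix (Fin 2) (Fin 2) R) = !![a, b; c, e] := by
    rw [ha, hb, hc, he]
    exact Matrix.eta_fin_two _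
  let g : GL (Fin 2) R := ⟨!![1, a; 0, c], !![1, -a * c'; 0, c'],
    by simp [Matrix.one_fin_two]; grind,
    by ext i j; fin_cases i <;> fin_cases j <;>
        simp [Matrix.mul_apply, Fin.sum_univ_two] <;> grind⟩
  let D : GL (Fin 2) R := ⟨!![2, 0; 0, 1], !![i2, 0; 0, 1],
    by simp [Matrix.one_fin_two, hi2], by simp [Matrix.one_fin_two, mul_comm i2, hi2]⟩
  obtain ⟨m, hmN, hm⟩ : ∃ m ∈ N, (m : Matrix (Fin 2) (Fin 2) R) =
      !![0, -(a * e - b * c); 1, a + e] := by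
    refine ⟨g⁻¹ * n * g⁻¹⁻¹, Subgroup.Normal.conj_mem ‹_› n hn g⁻¹, ?_⟩
    have : (n : Matrix (Fin 2) (Fin 2) R) * (g : Matrix (Fin 2) (Fin 2) R) =
        (g : Matrix (Fin 2) (Fin 2) R) * !![0, -(a * e - b * c); 1, a + e] := by
      rw [hnm]
      ext i j
      fin_cases i <;> fin_cases j <;>
        simp [g] <;> ring
    rw [inv_inv, mul_assoc, Units.val_mul, Units.val_mul, this, Units.inv_mul_cancel_left]
  obtain ⟨h, hhN, hh⟩ : ∃ h ∈ N, (h : Matrix (Fin 2) (Fin 2) R) =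
      !![i2, -(a + e); 0, 2] := by
    refine ⟨m⁻¹ * (D * m * D⁻¹),
      N.mul_mem (N.inv_mem hmN) (Subgroup.Normal.conj_mem ‹_› m hmN D), ?_⟩
    have : (D : Matrix (Fin 2) (Fin 2) R) * (m : Matrix (Fin 2) (Fin 2) R) =
        (m : Matrix (Fin 2) (Fin 2) R) * !![i2, -(a + e); 0, 2] *
          (D : Matrix (Fin 2) (Fin 2) R) := by
      rw [hm]
      ext i j
      fin_cases i <;> fin_cases j <;>
        simp [D, Matrix.mul_apply, Fin.sum_univ_two] <;> grind
    rw [Units.val_mul, Units.val_mul, Units.val_mul, this, Units.mul_inv_cancel_right,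
      Units.inv_mul_cancel_left]
  have hU : ∀ r : R, upperUnipotent r ∈ N := by
    intro r
    have h5 : h * (upperUnipotent (-(r * 4 * i3)) * h⁻¹ * (upperUnipotent (-(r * 4 * i3)))⁻¹) ∈ N :=
      N.mul_mem hhN (Subgroup.Normal.conj_mem ‹_› _ (N.inv_mem hhN) _)
    convert h5 using 1
    rw [← mul_assoc, ← mul_assoc, eq_mul_inv_iff_mul_eq, eq_mul_inv_iff_mul_eq]
    apply Units.ext
    rw [Units.val_mul, Units.val_mul, Units.val_mul, hh]
    ext i j
    fin_cases i <;> fin_cases j <;>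
      simp [upperUnipotent, Matrix.mul_apply, Fin.sum_univ_two]
    grind
  refine mem_of_unipotent_mem N hU (fun r ↦ ?_) x hx
  have h6 := Subgroup.Normal.conj_mem ‹N.Normal› _ (hU r) (swapGL R)
  convert h6 using 1
  rw [eq_mul_inv_iff_mul_eq]
  apply Units.ext
  simp [upperUnipotent, lowerUnipotent, swapGL]

/-- Over a local ring in which `6` is invertible, a normal subgroup of `GL(2, R)` containing an
element that is not scalar modulo the maximal ideal contains `SL(2, R)`. -/
theorem mem_of_normal_of_not_scalar (h2 : IsUnit (2 : R)) (h3 : IsUnit (3 : R))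
    (N : Subgroup (GL (Fin 2) R)) [N.Normal] (n : GL (Fin 2) R) (hn : n ∈ N)
    (hns : IsUnit ((n : Matrix (Fin 2) (Fin 2) R) 1 0) ∨
      IsUnit ((n : Matrix (Fin 2) (Fin 2) R) 0 1) ∨
      IsUnit ((n : Matrix (Fin 2) (Fin 2) R) 0 0 - (n : Matrix (Fin 2) (Fin 2) R) 1 1))
    (x : GL (Fin 2) R) (hx : (x : Matrix (Fin 2) (Fin 2) R).det = 1) : x ∈ N := by
  by_cases hc : IsUnit ((n : Matrix (Fin 2) (Fin 2) R) 1 0)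
  · exact mem_of_normal_of_isUnit_lower h2 h3 N n hn hc x hx
  by_cases hb : IsUnit ((n : Matrix (Fin 2) (Fin 2) R) 0 1)
  · refine mem_of_normal_of_isUnit_lower h2 h3 N _
      (Subgroup.Normal.conj_mem ‹N.Normal› _ hn (swapGL R)) ?_ x hx
    have h4 : ((swapGL R * n * (swapGL R)⁻¹ : GL (Fin 2) R) : Matrix (Fin 2) (Fin 2) R) 1 0 =
        (n : Matrix (Fin 2) (Fin 2) R) 0 1 := by
      rw [Units.val_mul, Units.val_mul, Matrix.eta_fin_two (n : Matrix (Fin 2) (Fin 2) R)]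
      simp [swapGL]
    rwa [h4]
  · have hd := (hns.resolve_left hc).resolve_left hb
    refine mem_of_normal_of_isUnit_lower h2 h3 N _
      (Subgroup.Normal.conj_mem ‹N.Normal› _ hn (lowerUnipotent 1)) ?_ x hx
    have h4 : ((lowerUnipotent 1 * n * (lowerUnipotent 1)⁻¹ : GL (Fin 2) R) :
        Matrix (Fin 2) (Fin 2) R) 1 0 =
        (n : Matrix (Fin 2) (Fin 2) R) 0 0 - (n : Matrix (Fin 2) (Fin 2) R) 1 1 +
        ((n : Matrix (Fin 2) (Fin 2) R) 1 0 - (n : Matrix (Fin 2) (Fin 2) R) 0 1) := by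
      rw [Units.val_mul, Units.val_mul, Matrix.eta_fin_two (n : Matrix (Fin 2) (Fin 2) R)]
      simp [lowerUnipotent]
      ring
    rw [h4]
    have hcb : (n : Matrix (Fin 2) (Fin 2) R) 1 0 - (n : Matrix (Fin 2) (Fin 2) R) 0 1 ∈
        IsLocalRing.maximalIdeal R :=
      Ideal.sub_mem _ hc hb
    by_contra h5
    have h6 := Ideal.sub_mem (IsLocalRing.maximalIdeal R) h5 hcb
    rw [add_sub_cancel_right] at h6
    exact h6 hd

end LocalRing

section FiniteField

variable {p : ℕ} [Fact p.Prime]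

theorem upperUnipotent_one_pow {R : Type*} [CommRing R] (n : ℕ) :
    (upperUnipotent (1 : R)) ^ n = upperUnipotent (n : R) := by
  induction n with
  | zero => apply Units.ext; simp [upperUnipotent, Matrix.one_fin_two]
  | succ n ih =>
    rw [pow_succ, ih]
    apply Units.ext
    simp [upperUnipotent, add_comm]

theorem lowerUnipotent_one_pow {R : Type*} [CommRing R] (n : ℕ) :
    (lowerUnipotent (1 : R)) ^ n = lowerUnipotent (n : R) := by
  induction n with
  | zero => apply Units.ext; simp [lowerUnipotent, Matrix.one_fin_two]
  | succ n ih =>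
    rw [pow_succ, ih]
    apply Units.ext
    simp [lowerUnipotent]

theorem mem_of_unipotent_one_mem (N : Subgroup (GL (Fin 2) (ZMod p)))
    (hU : upperUnipotent 1 ∈ N) (hL : lowerUnipotent 1 ∈ N)
    (x : GL (Fin 2) (ZMod p)) (hx : (x : Matrix (Fin 2) (Fin 2) (ZMod p)).det = 1) : x ∈ N := by
  refine mem_of_unipotent_mem N (fun r ↦ ?_) (fun r ↦ ?_) x hx
  · obtain ⟨n, rfl⟩ := ZMod.natCast_zmod_surjective r
    rw [← upperUnipotent_one_pow]
    exact N.pow_mem hU n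
  · obtain ⟨n, rfl⟩ := ZMod.natCast_zmod_surjective r
    rw [← lowerUnipotent_one_pow]
    exact N.pow_mem hL n

theorem exists_entries_of_pow_prime_eq_one (a : GL (Fin 2) (ZMod p)) (ha : a ^ p = 1) :
    ∃ α β γ : ZMod p, (a : Matrix (Fin 2) (Fin 2) (ZMod p)) = !![1 + α, β; γ, 1 - α] ∧
      α * α + β * γ = 0 := by
  have hp : p ≠ 0 := (Fact.out : p.Prime).ne_zero
  have hA : ((a : Matrix (Fin 2) (Fin 2) (ZMod p)) - 1) ^ p = 0 := by
    rw [sub_pow_char_of_commute _ (Commute.one_right _), one_pow, ← Units.val_pow_eq_pow_val, ha]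
    simp
  have htr := (Matrix.isNilpotent_trace_of_isNilpotent ⟨p, hA⟩).eq_zero
  have hdet : ((a : Matrix (Fin 2) (Fin 2) (ZMod p)) - 1).det = 0 := by
    have := congrArg Matrix.det hA
    rw [Matrix.det_pow, Matrix.det_zero] at this
    exact pow_eq_zero_iff hp |>.mp this
  rw [Matrix.trace_fin_two] at htr
  rw [Matrix.det_fin_two] at hdet
  simp at htr hdet
  refine ⟨(a : Matrix (Fin 2) (Fin 2) (ZMod p)) 0 0 - 1, (a : Matrix (Fin 2) (Fin 2) (ZMod p)) 0 1,
    (a : Matrix (Fin 2) (Fin 2) (ZMod p)) 1 0, ?_, ?_⟩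
  · ext i j
    fin_cases i <;> fin_cases j <;> simp
    linear_combination htr
  · linear_combination ((a : Matrix (Fin 2) (Fin 2) (ZMod p)) 0 0 - 1) * htr - hdet

theorem eq_one_or_neg_one_of_scalar {F : Type*} [Field F] (x : GL (Fin 2) F)
    (h01 : (x : Matrix (Fin 2) (Fin 2) F) 0 1 = 0) (h10 : (x : Matrix (Fin 2) (Fin 2) F) 1 0 = 0)
    (hd : (x : Matrix (Fin 2) (Fin 2) F) 0 0 = (x : Matrix (Fin 2) (Fin 2) F) 1 1)
    (hdet : (x : Matrix (Fin 2) (Fin 2) F).det = 1) : x = 1 ∨ x = -1 := by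
  rw [Matrix.det_fin_two, h01, hd, zero_mul, sub_zero, mul_self_eq_one_iff] at hdet
  rcases hdet with h | h
  · left
    apply Units.ext
    rw [Matrix.eta_fin_two (x : Matrix (Fin 2) (Fin 2) F), hd, h01, h10, h]
    simp [Matrix.one_fin_two]
  · right
    apply Units.ext
    rw [Matrix.eta_fin_two (x : Matrix (Fin 2) (Fin 2) F), hd, h01, h10, h]
    simp [Matrix.one_fin_two]

theorem trace_eq_zero_of_sq_eq {F : Type*} [Field F] (w : GL (Fin 2) F)
    (hdet : (w : Matrix (Fin 2) (Fin 2) F).det = 1) (hsq : w * w = 1 ∨ w * w = -1)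
    (hw : ¬ (w = 1 ∨ w = -1)) : (w : Matrix (Fin 2) (Fin 2) F).trace = 0 := by
  by_contra htr
  apply hw
  obtain ⟨c, hc⟩ : ∃ c : F, (w : Matrix (Fin 2) (Fin 2) F) * (w : Matrix (Fin 2) (Fin 2) F) =
      !![c, 0; 0, c] := by
    rcases hsq with h | h
    · exact ⟨1, by rw [← Units.val_mul, h]; simp [Matrix.one_fin_two]⟩
    · exact ⟨-1, by rw [← Units.val_mul, h]; simp [Matrix.one_fin_two]⟩
  rw [Matrix.trace_fin_two] at htr
  have h00 := congrFun (congrFun hc 0) 0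
  have h01 := congrFun (congrFun hc 0) 1
  have h10 := congrFun (congrFun hc 1) 0
  have h11 := congrFun (congrFun hc 1) 1
  simp [Matrix.mul_apply, Fin.sum_univ_two] at h00 h01 h10 h11
  refine eq_one_or_neg_one_of_scalar w ?_ ?_ ?_ hdet
  · apply mul_right_cancel₀ htr
    linear_combination h01
  · apply mul_right_cancel₀ htr
    linear_combination h10
  · apply mul_right_cancel₀ htr
    linear_combination h00 - h11

theorem exists_conj_of_trace_mul_eq_one {F : Type*} [Field F] {α β γ α' β' γ' : F}
    (hA : α * α + β * γ = 0) (hB : α' * α' + β' * γ' = 0)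
    (ht : 2 * α * α' + β * γ' + γ * β' = 1) :
    ∃ g : GL (Fin 2) F,
      !![1 + α, β; γ, 1 - α] * (g : Matrix (Fin 2) (Fin 2) F) =
        (g : Matrix (Fin 2) (Fin 2) F) * (upperUnipotent (1 : F) : GL (Fin 2) F) ∧
      !![1 + α', β'; γ', 1 - α'] * (g : Matrix (Fin 2) (Fin 2) F) =
        (g : Matrix (Fin 2) (Fin 2) F) * (lowerUnipotent (1 : F) : GL (Fin 2) F) := by
  by_cases hγ : γ' = 0
  · subst hγ
    have hα : α' = 0 := by simpa using hB
    subst hα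
    have hβ : β' ≠ 0 := by
      rintro rfl
      simp at ht
    refine ⟨Matrix.GeneralLinearGroup.mkOfDetNeZero !![α * β', β'; γ * β', 0] ?_, ?_, ?_⟩
    · rw [Matrix.det_fin_two_of]
      grind
    · ext i j
      fin_cases i <;> fin_cases j <;>
        simp [Matrix.GeneralLinearGroup.mkOfDetNeZero, upperUnipotent] <;> grind
    · ext i j
      fin_cases i <;> fin_cases j <;>
        simp [Matrix.GeneralLinearGroup.mkOfDetNeZero, lowerUnipotent]
      grind
  · refine ⟨Matrix.GeneralLinearGroup.mkOfDetNeZero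
      !![α * α' + β * γ', α'; γ * α' - α * γ', γ'] ?_, ?_, ?_⟩
    · rw [Matrix.det_fin_two_of]
      grind
    · ext i j
      fin_cases i <;> fin_cases j <;>
        simp [Matrix.GeneralLinearGroup.mkOfDetNeZero, upperUnipotent] <;> grind
    · ext i j
      fin_cases i <;> fin_cases j <;>
        simp [Matrix.GeneralLinearGroup.mkOfDetNeZero, lowerUnipotent] <;> grind

/-- A matrix of determinant one commuting with both elementary unipotents is `1` or `-1`. -/
theorem eq_one_or_neg_one_of_commute {F : Type*} [Field F] (k : GL (Fin 2) F)
    (hdet : (k : Matrix (Fin 2) (Fin 2) F).det = 1)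
    (hU : k * upperUnipotent 1 = upperUnipotent 1 * k)
    (hL : k * lowerUnipotent 1 = lowerUnipotent 1 * k) : k = 1 ∨ k = -1 := by
  have hU' := congrArg Units.val hU
  have hL' := congrArg Units.val hL
  rw [Units.val_mul, Units.val_mul, Matrix.eta_fin_two (k : Matrix (Fin 2) (Fin 2) F)] at hU' hL'
  simp [upperUnipotent, lowerUnipotent] at hU' hL'
  exact eq_one_or_neg_one_of_scalar k (by grind) (by grind) (by grind) hdet

theorem exists_conj_of_fibre_subgroup (hp : p ≠ 2)
    (M : Subgroup (GL (Fin 2) (ZMod p) × GL (Fin 2) (ZMod p)))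
    (hdet : ∀ z ∈ M, (z.1 : Matrix (Fin 2) (Fin 2) (ZMod p)).det =
      (z.2 : Matrix (Fin 2) (Fin 2) (ZMod p)).det)
    (hneg₁ : (-1, 1) ∈ M) (hneg₂ : (1, -1) ∈ M)
    (h₁ : ∀ x, (x, 1) ∈ M → x = 1 ∨ x = -1) (h₂ : ∀ y, (1, y) ∈ M → y = 1 ∨ y = -1)
    (hU : ∃ a, (a, upperUnipotent 1) ∈ M) (hL : ∃ b, (b, lowerUnipotent 1) ∈ M) :
    ∃ g : GL (Fin 2) (ZMod p), ∀ z ∈ M, z.1 = g * z.2 * g⁻¹ ∨ z.1 = -(g * z.2 * g⁻¹) := by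
  have hpodd : Odd p := (Fact.out : p.Prime).odd_of_ne_two hp
  have h2 : (2 : ZMod p) ≠ 0 := by
    have : Fact (2 < p) := ⟨lt_of_le_of_ne (Fact.out : p.Prime).two_le hp.symm⟩
    intro h
    apply ZMod.neg_one_ne_one (n := p)
    linear_combination -h
  have hsign : ∀ x y, (x, y) ∈ M → (-x, y) ∈ M := by
    intro x y h
    simpa using M.mul_mem hneg₁ h
  have hlift : ∀ y, y ^ p = 1 → (∃ x, (x, y) ∈ M) → ∃ x, (x, y) ∈ M ∧ x ^ p = 1 := by
    rintro y hy ⟨x, hx⟩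
    have h3 := M.pow_mem hx p
    rw [Prod.pow_mk, hy] at h3
    rcases h₁ _ h3 with h | h
    · exact ⟨x, hx, h⟩
    · exact ⟨-x, hsign x y hx, by rw [hpodd.neg_pow, h, neg_neg]⟩
  obtain ⟨a, haM, hap⟩ := hlift _ (by
    rw [upperUnipotent_one_pow, CharP.cast_eq_zero]
    apply Units.ext
    simp [upperUnipotent, Matrix.one_fin_two]) hU
  obtain ⟨b, hbM, hbp⟩ := hlift _ (by
    rw [lowerUnipotent_one_pow, CharP.cast_eq_zero]
    apply Units.ext
    simp [lowerUnipotent, Matrix.one_fin_two]) hL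
  obtain ⟨α, β, γ, ha, hA⟩ := exists_entries_of_pow_prime_eq_one a hap
  obtain ⟨α', β', γ', hb, hB⟩ := exists_entries_of_pow_prime_eq_one b hbp
  have hwM := M.mul_mem (M.mul_mem haM (M.inv_mem hbM)) haM
  simp only [Prod.inv_mk, Prod.mk_mul_mk] at hwM
  have hs : ((upperUnipotent 1 * (lowerUnipotent 1)⁻¹ * upperUnipotent 1 :
      GL (Fin 2) (ZMod p)) : Matrix (Fin 2) (Fin 2) (ZMod p)) = !![0, 1; -1, 0] := by
    simp [upperUnipotent, lowerUnipotent]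
  set s : GL (Fin 2) (ZMod p) := upperUnipotent 1 * (lowerUnipotent 1)⁻¹ * upperUnipotent 1
  have hss : s * s = -1 := by
    apply Units.ext
    rw [Units.val_mul, hs]
    simp [Matrix.one_fin_two]
  have hs1 : ¬ (s = 1 ∨ s = -1) := by
    rintro (h | h) <;>
    · have := congrArg (fun z : GL (Fin 2) (ZMod p) ↦
        (z : Matrix (Fin 2) (Fin 2) (ZMod p)) 0 1) h
      simp [hs] at this
  have hbinv : ((b⁻¹ : GL (Fin 2) (ZMod p)) : Matrix (Fin 2) (Fin 2) (ZMod p)) =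
      !![1 - α', -β'; -γ', 1 + α'] := by
    apply Units.inv_eq_of_mul_eq_one_right
    rw [hb]
    ext i j
    fin_cases i <;> fin_cases j <;> simp <;> grind
  have htr := trace_eq_zero_of_sq_eq (a * b⁻¹ * a) (by
      rw [hdet _ hwM, hs]
      simp) (by
      have h3 := M.mul_mem (M.mul_mem hwM hwM) hneg₂
      simp only [Prod.mk_mul_mk, mul_one, hss, mul_neg, neg_neg] at h3
      exact h₁ _ h3) (by
      rintro (h | h)
      · rw [h] at hwM
        exact hs1 (h₂ _ hwM)
      · rw [h] at hwM
        exact hs1 (h₂ _ (by simpa using hsign _ _ hwM)))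
  have ht : 2 * α * α' + β * γ' + γ * β' = 1 := by
    rw [Units.val_mul, Units.val_mul, ha, hbinv, Matrix.trace_fin_two] at htr
    simp at htr
    apply mul_left_cancel₀ h2
    grind
  obtain ⟨g, hgU, hgL⟩ := exists_conj_of_trace_mul_eq_one hA hB ht
  rw [← ha, ← Units.val_mul, ← Units.val_mul, Units.val_inj, ← eq_mul_inv_iff_mul_eq] at hgU
  rw [← hb, ← Units.val_mul, ← Units.val_mul, Units.val_inj, ← eq_mul_inv_iff_mul_eq] at hgL
  have hdiag : ∀ x : GL (Fin 2) (ZMod p), (x : Matrix (Fin 2) (Fin 2) (ZMod p)).det = 1 →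
      (g * x * g⁻¹, x) ∈ M := by
    intro x hx
    exact mem_of_unipotent_one_mem
      (M.comap ((MulAut.conj g).toMonoidHom.prod (MonoidHom.id _)))
      (by simpa [hgU] using haM) (by simpa [hgL] using hbM) x hx
  have hcomm : ∀ x y, (x, y) ∈ M → ∀ u : GL (Fin 2) (ZMod p),
      (u : Matrix (Fin 2) (Fin 2) (ZMod p)).det = 1 →
      (u : Matrix (Fin 2) (Fin 2) (ZMod p)).trace = 2 →
      y⁻¹ * g⁻¹ * x * g * u = u * (y⁻¹ * g⁻¹ * x * g) := by
    intro x y hxy u hu hut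
    have h3 := M.mul_mem (M.mul_mem hxy (hdiag u hu)) (M.inv_mem hxy)
    simp only [Prod.inv_mk, Prod.mk_mul_mk] at h3
    have h4 := M.mul_mem h3 (M.inv_mem (hdiag (y * u * y⁻¹) (by
      rw [Units.val_mul, Units.val_mul, Matrix.det_units_conj, hu])))
    simp only [Prod.inv_mk, Prod.mk_mul_mk, mul_inv_cancel] at h4
    rcases h₁ _ h4 with h5 | h5
    · rw [mul_inv_eq_one] at h5
      have := congrArg (fun z ↦ y⁻¹ * g⁻¹ * z * x * g) h5
      simpa [mul_assoc] using this
    · exfalso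
      rw [mul_inv_eq_iff_eq_mul, neg_one_mul] at h5
      have h6 := congrArg (fun z : GL (Fin 2) (ZMod p) ↦
        (z : Matrix (Fin 2) (Fin 2) (ZMod p)).trace) h5
      have hconj : ∀ q r : GL (Fin 2) (ZMod p),
          ((q * r * q⁻¹ : GL (Fin 2) (ZMod p)) : Matrix (Fin 2) (Fin 2) (ZMod p)).trace =
            (r : Matrix (Fin 2) (Fin 2) (ZMod p)).trace := fun q r ↦ by
        rw [Units.val_mul, Units.val_mul, Matrix.trace_units_conj]
      rw [Units.val_neg, Matrix.trace_neg, hconj, hconj, hconj, hconj, hut] at h6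
      exact (mul_ne_zero h2 h2) (by linear_combination h6)
  refine ⟨g, fun ⟨x, y⟩ hxy ↦ ?_⟩
  rcases eq_one_or_neg_one_of_commute (y⁻¹ * g⁻¹ * x * g) (by
      rw [mul_assoc, mul_assoc, ← mul_assoc g⁻¹, Units.val_mul, Matrix.det_mul, Units.val_mul,
        Units.val_mul, Matrix.det_units_conj', hdet _ hxy, ← Matrix.det_mul, Units.inv_mul,
        Matrix.det_one]) (hcomm x y hxy _ (by simp [upperUnipotent]) (by
        simp [upperUnipotent, Matrix.trace_fin_two, one_add_one_eq_two]))
      (hcomm x y hxy _ (by simp [lowerUnipotent]) (by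
        simp [lowerUnipotent, Matrix.trace_fin_two, one_add_one_eq_two])) with h | h
  · left
    have := congrArg (fun z ↦ g * y * z * g⁻¹) h
    simpa [mul_assoc] using this
  · right
    have := congrArg (fun z ↦ g * y * z * g⁻¹) h
    simpa [mul_assoc] using this

end FiniteField

section Padic

open Filter Topology

variable {p : ℕ} [Fact p.Prime]

/-- Entrywise reduction modulo `p` as a group homomorphism. -/
noncomputable def reduceGL (p : ℕ) [Fact p.Prime] : GL (Fin 2) ℤ_[p] →* GL (Fin 2) (ZMod p) :=
  Matrix.GeneralLinearGroup.map PadicInt.toZMod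

theorem reduceGL_apply (x : GL (Fin 2) ℤ_[p]) (i j : Fin 2) :
    (reduceGL p x : Matrix (Fin 2) (Fin 2) (ZMod p)) i j =
      PadicInt.toZMod ((x : Matrix (Fin 2) (Fin 2) ℤ_[p]) i j) :=
  rfl

theorem det_reduceGL (x : GL (Fin 2) ℤ_[p]) :
    (reduceGL p x : Matrix (Fin 2) (Fin 2) (ZMod p)).det =
      PadicInt.toZMod (x : Matrix (Fin 2) (Fin 2) ℤ_[p]).det :=
  (RingHom.map_det _ _).symm

theorem isUnit_of_toZMod_ne_zero {x : ℤ_[p]} (hx : PadicInt.toZMod x ≠ 0) : IsUnit x := by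
  by_contra h
  have h1 : x ∈ IsLocalRing.maximalIdeal ℤ_[p] := h
  rw [← PadicInt.ker_toZMod] at h1
  exact hx h1

theorem isUnit_natCast_of_lt {n : ℕ} (h0 : 0 < n) (hn : n < p) : IsUnit (n : ℤ_[p]) := by
  apply isUnit_of_toZMod_ne_zero
  rw [map_natCast, Ne, ZMod.natCast_eq_zero_iff]
  exact Nat.not_dvd_of_pos_of_lt h0 hn

theorem dvd_of_toZMod_eq_zero {x : ℤ_[p]} (hx : PadicInt.toZMod x = 0) : (p : ℤ_[p]) ∣ x := by
  have h : x ∈ RingHom.ker (PadicInt.toZMod : ℤ_[p] →+* ZMod p) := hx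
  rwa [PadicInt.ker_toZMod, PadicInt.maximalIdeal_eq_span_p, Ideal.mem_span_singleton] at h

/-- A matrix congruent to `1` modulo `p` is topologically unipotent. -/
theorem tendsto_pow_prime_pow_of_map_toZMod_eq_one (A : Matrix (Fin 2) (Fin 2) ℤ_[p])
    (hA : A.map PadicInt.toZMod = 1) : Tendsto (fun k : ℕ ↦ A ^ p ^ k) atTop (𝓝 1) := by
  obtain ⟨B, hB⟩ : ∃ B : Matrix (Fin 2) (Fin 2) ℤ_[p], A = 1 + (p : ℤ_[p]) • B := by
    have h : ∀ i j, ∃ b, A i j - (1 : Matrix (Fin 2) (Fin 2) ℤ_[p]) i j = (p : ℤ_[p]) * b := by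
      intro i j
      apply dvd_of_toZMod_eq_zero
      have := congrFun (congrFun hA i) j
      rw [Matrix.map_apply] at this
      rw [map_sub, this, Matrix.one_apply, Matrix.one_apply]
      split_ifs <;> simp
    choose B hB using h
    refine ⟨Matrix.of B, ?_⟩
    ext i j
    simp [← hB]
  have hpow : ∀ k : ℕ, ∃ C : Matrix (Fin 2) (Fin 2) ℤ_[p],
      A ^ p ^ k = 1 + (p : ℤ_[p]) ^ (k + 1) • C := by
    intro k
    obtain ⟨q, hq⟩ := dvd_sub_pow_of_dvd_sub (p := p) (R := Polynomial ℤ_[p])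
      (a := 1 + Polynomial.C (p : ℤ_[p]) * Polynomial.X) (b := 1) ⟨Polynomial.X, by simp⟩ k
    refine ⟨Polynomial.aeval B q, ?_⟩
    rw [one_pow, sub_eq_iff_eq_add'] at hq
    have h := congrArg (Polynomial.aeval B) hq
    have hc : ((p : Polynomial ℤ_[p]) ^ (k + 1)) = Polynomial.C ((p : ℤ_[p]) ^ (k + 1)) := by simp
    rw [hc, ← Polynomial.smul_eq_C_mul, ← Polynomial.smul_eq_C_mul] at h
    simpa [← hB] using h
  choose C hC using hpow
  refine tendsto_pi_nhds.2 fun i ↦ tendsto_pi_nhds.2 fun j ↦ ?_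
  rw [tendsto_iff_norm_sub_tendsto_zero]
  have hp1 : (p : ℝ)⁻¹ < 1 := inv_lt_one_of_one_lt₀ (by exact_mod_cast (Fact.out : p.Prime).one_lt)
  refine squeeze_zero (fun _ ↦ norm_nonneg _) (fun k ↦ ?_)
    ((tendsto_pow_atTop_nhds_zero_of_lt_one (by positivity) hp1).comp (tendsto_add_atTop_nat 1))
  rw [hC]
  simp only [Matrix.add_apply, Matrix.smul_apply, add_sub_cancel_left, smul_eq_mul, norm_mul,
    norm_pow, PadicInt.norm_p, Function.comp_apply]
  exact mul_le_of_le_one_right (by positivity) (PadicInt.norm_le_one _)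

theorem tendsto_pow_prime_pow_of_reduceGL_eq_one (y : GL (Fin 2) ℤ_[p]) (hy : reduceGL p y = 1) :
    Tendsto (fun k : ℕ ↦ y ^ p ^ k) atTop (𝓝 1) := by
  have hval : ∀ z : GL (Fin 2) ℤ_[p], reduceGL p z = 1 →
      Tendsto (fun k : ℕ ↦ ((z ^ p ^ k : GL (Fin 2) ℤ_[p]) : Matrix (Fin 2) (Fin 2) ℤ_[p]))
        atTop (𝓝 1) := by
    intro z hz
    simp only [Units.val_pow_eq_pow_val]
    exact tendsto_pow_prime_pow_of_map_toZMod_eq_one _ (congrArg Units.val hz)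
  rw [Units.isInducing_embedProduct.tendsto_nhds_iff]
  refine (hval y hy).prodMk_nhds (MulOpposite.continuous_op.continuousAt.tendsto.comp ?_)
  have := hval y⁻¹ (by rw [map_inv, hy, inv_one])
  simpa only [inv_pow, inv_one, Units.val_one] using this

/-- A closed subgroup of the fibre product whose first projection is onto contains every pair of
matrices of equal determinant as soon as it contains `(x, y)` with `y ≡ ±1` and `x ≢ ±1`
modulo `p`. -/
theorem mem_of_reduceGL_eq_one_or_neg_one (hp5 : 5 ≤ p)
    (H : Subgroup (GL (Fin 2) ℤ_[p] × GL (Fin 2) ℤ_[p]))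
    (hdet : ∀ z ∈ H, (z.1 : Matrix (Fin 2) (Fin 2) ℤ_[p]).det =
      (z.2 : Matrix (Fin 2) (Fin 2) ℤ_[p]).det)
    (hclosed : IsClosed (H : Set (GL (Fin 2) ℤ_[p] × GL (Fin 2) ℤ_[p])))
    (hsurj₁ : ∀ x : GL (Fin 2) ℤ_[p], ∃ y, (x, y) ∈ H)
    (hsurj₂ : ∀ y : GL (Fin 2) ℤ_[p], ∃ x, (x, y) ∈ H)
    {x₀ y₀ : GL (Fin 2) ℤ_[p]} (hxy₀ : (x₀, y₀) ∈ H)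
    (hy₀ : reduceGL p y₀ = 1 ∨ reduceGL p y₀ = -1)
    (hx₀ : ¬ (reduceGL p x₀ = 1 ∨ reduceGL p x₀ = -1))
    (x y : GL (Fin 2) ℤ_[p]) (hxy : (x : Matrix (Fin 2) (Fin 2) ℤ_[p]).det =
      (y : Matrix (Fin 2) (Fin 2) ℤ_[p]).det) : (x, y) ∈ H := by
  have h2 : IsUnit (2 : ℤ_[p]) := by
    exact_mod_cast isUnit_natCast_of_lt (p := p) (n := 2) (by omega) (by omega)
  have h3 : IsUnit (3 : ℤ_[p]) := by
    exact_mod_cast isUnit_natCast_of_lt (p := p) (n := 3) (by omega) (by omega)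
  let K : Subgroup (GL (Fin 2) ℤ_[p]) :=
    (H ⊓ (Subgroup.zpowers (-1)).comap ((reduceGL p).comp (MonoidHom.snd _ _))).map
      (MonoidHom.fst _ _)
  have hzp : ∀ z : GL (Fin 2) (ZMod p), z ∈ Subgroup.zpowers (-1) ↔ z = 1 ∨ z = -1 := by
    intro z
    constructor
    · rintro ⟨n, rfl⟩
      rcases Int.even_or_odd n with h | h
      · exact .inl h.neg_one_zpow
      · exact .inr h.neg_one_zpow
    · rintro (rfl | rfl)
      · exact one_mem _
      · exact Subgroup.mem_zpowers _
  have hK : ∀ z, z ∈ K ↔ ∃ w, (z, w) ∈ H ∧ (reduceGL p w = 1 ∨ reduceGL p w = -1) := by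
    intro z
    simp [K, hzp]
  have : K.Normal := by
    refine ⟨fun n hn g ↦ ?_⟩
    rw [hK] at hn ⊢
    obtain ⟨w, hw, hw'⟩ := hn
    obtain ⟨g', hg'⟩ := hsurj₁ g
    have hconj := H.mul_mem (H.mul_mem hg' hw) (H.inv_mem hg')
    rw [Prod.inv_mk, Prod.mk_mul_mk, Prod.mk_mul_mk] at hconj
    refine ⟨g' * w * g'⁻¹, hconj, ?_⟩
    rw [map_mul, map_mul, map_inv]
    rcases hw' with h | h
    · left
      rw [h, mul_one, mul_inv_cancel]
    · right
      rw [h, mul_neg_one, neg_mul, mul_inv_cancel]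
  have hT : orderThreeGL ℤ_[p] ∈ K := by
    refine mem_of_normal_of_not_scalar h2 h3 K x₀ ((hK _).2 ⟨y₀, hxy₀, hy₀⟩) ?_ _
      (by simp [orderThreeGL])
    by_contra! hns
    apply hx₀
    have hz : ∀ {t : ℤ_[p]}, ¬ IsUnit t → PadicInt.toZMod t = 0 := fun ht ↦
      by_contra fun h ↦ ht (isUnit_of_toZMod_ne_zero h)
    refine eq_one_or_neg_one_of_scalar _ ?_ ?_ ?_ ?_
    · rw [reduceGL_apply, hz hns.2.1]
    · rw [reduceGL_apply, hz hns.1]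
    · rw [reduceGL_apply, reduceGL_apply, ← sub_eq_zero, ← map_sub, hz hns.2.2]
    · rw [det_reduceGL, hdet _ hxy₀, ← det_reduceGL]
      rcases hy₀ with h | h <;> simp [h, Matrix.det_neg]
  obtain ⟨w, hwH, hw⟩ := (hK _).1 hT
  have hw2 : reduceGL p (w ^ 4) = 1 := by
    rw [map_pow]
    rcases hw with h | h <;> simp [h, Even.neg_pow (show Even 4 by decide)]
  have hpow : ∀ k : ℕ, (orderThreeGL ℤ_[p], (w ^ 4) ^ p ^ (2 * k)) ∈ H := by
    intro k
    have h4 := H.pow_mem hwH (4 * p ^ (2 * k))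
    rw [Prod.pow_mk, pow_mul w] at h4
    convert h4
    have h5 : 4 * p ^ (2 * k) % 3 = 1 := by
      have h6 : p ^ 2 ≡ 1 [MOD 3] := by
        have h7 : p % 3 ≠ 0 := fun h ↦ by
          have := (Nat.prime_dvd_prime_iff_eq Nat.prime_three (Fact.out : p.Prime)).1
            (Nat.dvd_of_mod_eq_zero h)
          omega
        have h8 : p % 3 = 1 ∨ p % 3 = 2 := by omega
        rcases h8 with h | h <;> simp [Nat.ModEq, Nat.pow_mod, h]
      have h9 := (h6.pow k).mul_left 4
      rwa [← pow_mul, one_pow] at h9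
    rw [← Nat.div_add_mod (4 * p ^ (2 * k)) 3, h5, pow_add, pow_mul, orderThreeGL_pow_three,
      one_pow, one_mul, pow_one]
  have hlim : (orderThreeGL ℤ_[p], 1) ∈ H := by
    have htwo : Tendsto (fun k : ℕ ↦ 2 * k) atTop atTop :=
      tendsto_id.const_mul_atTop' two_pos
    exact hclosed.mem_of_tendsto (tendsto_const_nhds.prodMk_nhds
      ((tendsto_pow_prime_pow_of_reduceGL_eq_one _ hw2).comp htwo))
      (Eventually.of_forall hpow)
  have hN : (H.comap (MonoidHom.inl _ (GL (Fin 2) ℤ_[p]))).Normal := by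
    refine ⟨fun n hn g ↦ ?_⟩
    obtain ⟨g', hg'⟩ := hsurj₁ g
    simpa using H.mul_mem (H.mul_mem hg' (Subgroup.mem_comap.1 hn)) (H.inv_mem hg')
  obtain ⟨x', hx'⟩ := hsurj₂ y
  have h10 : x * x'⁻¹ ∈ H.comap (MonoidHom.inl _ (GL (Fin 2) ℤ_[p])) := by
    refine mem_of_normal_of_not_scalar h2 h3 _ (orderThreeGL ℤ_[p]) hlim
      (.inl (by simp [orderThreeGL])) _ ?_
    rw [Units.val_mul, Matrix.det_mul, hxy, ← hdet _ hx', ← Matrix.det_mul, Units.mul_inv,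
      Matrix.det_one]
  simpa using H.mul_mem (Subgroup.mem_comap.1 h10) hx'

end Padic

/-- Let `p ≥ 5` and let `H` be a closed subgroup of
`G = {(x, y) ∈ GL(2,ℤ_p)² : det x = det y}` surjecting onto both `GL(2,ℤ_p)` factors.
Then either `H = G`, or there is `g ∈ GL(2, ℤ/pℤ)` such that every `(x, y) ∈ H` satisfies
`x̄ = ± g·ȳ·g⁻¹` modulo `p`. -/
theorem stmt13 (p : ℕ) [Fact p.Prime] (hp5 : 5 ≤ p)
    (H : Subgroup (GL (Fin 2) ℤ_[p] × GL (Fin 2) ℤ_[p]))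
    (hdet : ∀ z ∈ H, ((z.1 : GL (Fin 2) ℤ_[p]) : Matrix (Fin 2) (Fin 2) ℤ_[p]).det =
      ((z.2 : GL (Fin 2) ℤ_[p]) : Matrix (Fin 2) (Fin 2) ℤ_[p]).det)
    (hclosed : IsClosed (H : Set (GL (Fin 2) ℤ_[p] × GL (Fin 2) ℤ_[p])))
    (hsurj₁ : ∀ x : GL (Fin 2) ℤ_[p], ∃ y, (x, y) ∈ H)
    (hsurj₂ : ∀ y : GL (Fin 2) ℤ_[p], ∃ x, (x, y) ∈ H) :
    (∀ x y : GL (Fin 2) ℤ_[p],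
        ((x : Matrix (Fin 2) (Fin 2) ℤ_[p]).det = (y : Matrix (Fin 2) (Fin 2) ℤ_[p]).det) →
        (x, y) ∈ H) ∨
      ∃ g : GL (Fin 2) (ZMod p), ∀ z ∈ H,
        redp p z.1 = (g : Matrix (Fin 2) (Fin 2) (ZMod p)) * redp p z.2 *
            ((g⁻¹ : GL (Fin 2) (ZMod p)) : Matrix (Fin 2) (Fin 2) (ZMod p)) ∨
        redp p z.1 = -((g : Matrix (Fin 2) (Fin 2) (ZMod p)) * redp p z.2 *
            ((g⁻¹ : GL (Fin 2) (ZMod p)) : Matrix (Fin 2) (Fin 2) (ZMod p))) := by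
  have hdet' : ∀ z ∈ H, (reduceGL p z.1 : Matrix (Fin 2) (Fin 2) (ZMod p)).det =
      (reduceGL p z.2 : Matrix (Fin 2) (Fin 2) (ZMod p)).det := fun z hz ↦ by
    rw [det_reduceGL, det_reduceGL, hdet z hz]
  by_cases h₁ : ∃ x y, (x, y) ∈ H ∧ (reduceGL p y = 1 ∨ reduceGL p y = -1) ∧
      ¬ (reduceGL p x = 1 ∨ reduceGL p x = -1)
  · obtain ⟨x₀, y₀, hxy₀, hy₀, hx₀⟩ := h₁
    exact .inl (mem_of_reduceGL_eq_one_or_neg_one hp5 H hdet hclosed hsurj₁ hsurj₂ hxy₀ hy₀ hx₀)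
  by_cases h₂ : ∃ x y, (x, y) ∈ H ∧ (reduceGL p x = 1 ∨ reduceGL p x = -1) ∧
      ¬ (reduceGL p y = 1 ∨ reduceGL p y = -1)
  · obtain ⟨x₀, y₀, hxy₀, hx₀, hy₀⟩ := h₂
    refine .inl fun x y hxy ↦ ?_
    exact mem_of_reduceGL_eq_one_or_neg_one hp5
      (H.comap (MulEquiv.prodComm : GL (Fin 2) ℤ_[p] × GL (Fin 2) ℤ_[p] ≃* _).toMonoidHom)
      (fun z hz ↦ (hdet _ hz).symm) (hclosed.preimage continuous_swap) hsurj₂ hsurj₁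
      (x₀ := y₀) (y₀ := x₀) hxy₀ hx₀ hy₀ y x hxy.symm
  push Not at h₁ h₂
  right
  have hneg : ∀ {u v : GL (Fin 2) (ZMod p)}, (u = v ∨ u = -v) → (v = 1 ∨ v = -1) →
      (u = 1 ∨ u = -1) := by
    rintro u v (rfl | rfl) (rfl | rfl) <;> simp
  have hneg' : ∀ {u v : GL (Fin 2) (ZMod p)}, (u = v ∨ u = -v) → (u = 1 ∨ u = -1) →
      (v = 1 ∨ v = -1) := by
    rintro u v (rfl | rfl) h
    · exact h
    · rwa [neg_inj, neg_eq_iff_eq_neg, or_comm] at h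
  have hmul : ∀ {u v u' v' : GL (Fin 2) (ZMod p)}, (u = v ∨ u = -v) → (u' = v' ∨ u' = -v') →
      (u * u' = v * v' ∨ u * u' = -(v * v')) := by
    rintro u v u' v' (rfl | rfl) (rfl | rfl) <;> simp
  have hdet_neg : ∀ {u v : GL (Fin 2) (ZMod p)}, (u = v ∨ u = -v) →
      (u : Matrix (Fin 2) (Fin 2) (ZMod p)).det = (v : Matrix (Fin 2) (Fin 2) (ZMod p)).det := by
    rintro u v (rfl | rfl) <;> simp [Matrix.det_neg]
  let M : Subgroup (GL (Fin 2) (ZMod p) × GL (Fin 2) (ZMod p)) :=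
    { carrier := {z | ∃ h ∈ H, (z.1 = reduceGL p h.1 ∨ z.1 = -reduceGL p h.1) ∧
        (z.2 = reduceGL p h.2 ∨ z.2 = -reduceGL p h.2)}
      one_mem' := ⟨1, H.one_mem, by simp⟩
      mul_mem' := by
        rintro z z' ⟨h, hH, h1, h2⟩ ⟨h', hH', h1', h2'⟩
        refine ⟨h * h', H.mul_mem hH hH', ?_, ?_⟩
        · rw [Prod.fst_mul, Prod.fst_mul, map_mul]
          exact hmul h1 h1'
        · rw [Prod.snd_mul, Prod.snd_mul, map_mul]
          exact hmul h2 h2'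
      inv_mem' := by
        rintro z ⟨h, hH, h1, h2⟩
        refine ⟨h⁻¹, H.inv_mem hH, ?_, ?_⟩
        · rcases h1 with h1 | h1 <;> simp [h1]
        · rcases h2 with h2 | h2 <;> simp [h2] }
  have hU : reduceGL p (upperUnipotent 1) = upperUnipotent 1 := by
    apply Units.ext
    ext i j
    rw [reduceGL_apply]
    fin_cases i <;> fin_cases j <;> simp [upperUnipotent]
  have hL : reduceGL p (lowerUnipotent 1) = lowerUnipotent 1 := by
    apply Units.ext
    ext i j
    rw [reduceGL_apply]
    fin_cases i <;> fin_cases j <;> simp [lowerUnipotent]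
  obtain ⟨g, hg⟩ := exists_conj_of_fibre_subgroup (p := p) (by omega) M
    (by
      rintro z ⟨h, hH, h1, h2⟩
      rw [hdet_neg h1, hdet_neg h2, hdet' h hH])
    ⟨1, H.one_mem, by simp, by simp⟩ ⟨1, H.one_mem, by simp, by simp⟩
    (by
      rintro x ⟨h, hH, h1, h2⟩
      exact hneg h1 (h₁ _ _ hH (hneg' h2 (.inl rfl))))
    (by
      rintro x ⟨h, hH, h1, h2⟩
      exact hneg h2 (h₂ _ _ hH (hneg' h1 (.inl rfl))))
    (by
      obtain ⟨x, hx⟩ := hsurj₂ (upperUnipotent 1)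
      exact ⟨reduceGL p x, (x, upperUnipotent 1), hx, .inl rfl, .inl hU.symm⟩)
    (by
      obtain ⟨x, hx⟩ := hsurj₂ (lowerUnipotent 1)
      exact ⟨reduceGL p x, (x, lowerUnipotent 1), hx, .inl rfl, .inl hL.symm⟩)
  refine ⟨g, fun z hz ↦ ?_⟩
  rcases hg (reduceGL p z.1, reduceGL p z.2) ⟨z, hz, .inl rfl, .inl rfl⟩ with h | h
  · exact .inl (congrArg Units.val h)
  · exact .inr (congrArg Units.val h)
end

section
/- Let S be a finite set of prime numbers. Then there exists a family (γ_m), indexed by the squarefree positive integers m having no prime factor in S, with γ_m ∈ (ℤ/mℤ)ˣ for each such m, such that whenever m is a squarefree positive integer with no prime factor in S and ℓ is a prime not in S with ℓ ∤ m, the image of γ_{mℓ} under the natural reduction map (ℤ/mℓℤ)ˣ → (ℤ/mℤ)ˣ equals ℓ⁻¹·γ_m, where ℓ⁻¹ denotes the inverse of the class of ℓ in (ℤ/mℤ)ˣ. -/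
/-- The sum of `m / p` over the prime divisors `p` of `m`; for squarefree `m` this is the
arithmetic derivative of `m`. -/
def sumDivPrimeFactors (m : ℕ) : ℕ := ∑ p ∈ m.primeFactors, m / p

theorem sumDivPrimeFactors_mul_prime {m ℓ : ℕ} (hm : m ≠ 0) (hℓ : ℓ.Prime) (h : ¬ ℓ ∣ m) :
    sumDivPrimeFactors (m * ℓ) = m + ℓ * sumDivPrimeFactors m := by
  have hmem : ℓ ∉ m.primeFactors := fun hmem => h (Nat.dvd_of_mem_primeFactors hmem)
  unfold sumDivPrimeFactors
  rw [Nat.primeFactors_mul hm hℓ.ne_zero, hℓ.primeFactors, Finset.union_comm,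
    ← Finset.insert_eq, Finset.sum_insert hmem, Nat.mul_div_cancel _ hℓ.pos, Finset.mul_sum]
  congr 1
  refine Finset.sum_congr rfl fun p hp => ?_
  rw [mul_comm m, Nat.mul_div_assoc _ (Nat.dvd_of_mem_primeFactors hp)]

theorem coprime_sumDivPrimeFactors {m : ℕ} (hm : Squarefree m) :
    (sumDivPrimeFactors m).Coprime m := by
  refine Nat.coprime_of_dvd fun p hp hpD hpm => ?_
  obtain ⟨k, rfl⟩ := hpm
  have hk : ¬ p ∣ k := fun hpk =>
    hp.not_isUnit (hm p (mul_dvd_mul_left p hpk))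
  have hk0 : k ≠ 0 := fun h => hk (h ▸ dvd_zero p)
  rw [mul_comm, sumDivPrimeFactors_mul_prime hk0 hp hk] at hpD
  exact hk ((Nat.dvd_add_left (dvd_mul_right p _)).1 hpD)

/-- Given a finite set `S` of primes, there is a compatible system
`(γ_m)_m` of units `γ_m ∈ (ℤ/mℤ)ˣ`, indexed by the squarefree positive integers `m` with no
prime factor in `S`, such that for every prime `ℓ ∉ S` with `ℓ ∤ m`, the image of `γ_{mℓ}`
in `(ℤ/mℤ)ˣ` is `ℓ⁻¹ · γ_m`. -/
theorem stmt18 (S : Finset ℕ) (hS : ∀ q ∈ S, Nat.Prime q) :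
    ∃ γ : (m : ℕ) → (ZMod m)ˣ,
      ∀ m : ℕ, 0 < m → Squarefree m → (∀ q ∈ S, ¬ q ∣ m) →
        ∀ ℓ : ℕ, Nat.Prime ℓ → ℓ ∉ S → ¬ ℓ ∣ m →
          ∃ u : (ZMod m)ˣ, (u : ZMod m) = (ℓ : ZMod m) ∧
            ZMod.unitsMap (dvd_mul_right m ℓ) (γ (m * ℓ)) = u⁻¹ * γ m := by
  refine ⟨fun m => if h : (sumDivPrimeFactors m).Coprime m then
    (ZMod.unitOfCoprime _ h)⁻¹ else 1, fun m hm hsq _ ℓ hℓ _ hℓm => ?_⟩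
  have hcop : ℓ.Coprime m := (Nat.Prime.coprime_iff_not_dvd hℓ).2 hℓm
  have hsq' : Squarefree (m * ℓ) :=
    (Nat.squarefree_mul hcop.symm).2 ⟨hsq, hℓ.prime.squarefree⟩
  refine ⟨ZMod.unitOfCoprime ℓ hcop, ZMod.coe_unitOfCoprime ℓ hcop, ?_⟩
  simp only [dif_pos (coprime_sumDivPrimeFactors hsq), dif_pos (coprime_sumDivPrimeFactors hsq')]
  rw [map_inv, ← mul_inv, inv_inj]
  ext
  simp [ZMod.unitsMap_def, sumDivPrimeFactors_mul_prime hm.ne' hℓ hℓm]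
end
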